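/- Fix τ, σ ≥ 1 with σ dividing τ. For each n, choose an n-state 2-neighbor rule f uniformly at random, and let R_{τ,σ,n} be the set of weakly robust periodic solutions of f with temporal period τ and spatial period σ. Then there exists a constant c(τ, σ) depending only on τ and σ such that n · P(R_{τ,σ,n} ≠ ∅) → c(τ, σ) as n → ∞; that is, P(R_{τ,σ,n} ≠ ∅) = c(τ, σ)/n + o(1/n). -/

import Mathlib

open Filter

/-- An `n`-state 2-neighbor cellular automaton rule. -/
abbrev CARule (n : ℕ) := Fin n → Fin n → Fin n

/-- One step of the CA evolution: `ξ_{t+1}(x) = f(ξ_t(x-1), ξ_t(x))`. -/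
def caStep {n : ℕ} (f : CARule n) (ξ : ℤ → Fin n) : ℤ → Fin n :=
  fun x => f (ξ (x - 1)) (ξ x)

/-- The trajectory of an initial configuration under the rule `f`. -/
def caTraj {n : ℕ} (f : CARule n) (ξ : ℤ → Fin n) : ℕ → ℤ → Fin n
  | 0 => ξ
  | t + 1 => caStep f (caTraj f ξ t)

/-- `ξ` is (the initial configuration of) a periodic solution of `f` with
minimal temporal period `τ` and minimal spatial period `σ`. -/
def IsPS {n : ℕ} (f : CARule n) (ξ : ℤ → Fin n) (τ σ : ℕ) : Prop :=
  0 < τ ∧ 0 < σ ∧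
  (∀ x : ℤ, ξ (x + (σ : ℤ)) = ξ x) ∧
  (∀ σ' : ℕ, 0 < σ' → (∀ x : ℤ, ξ (x + (σ' : ℤ)) = ξ x) → σ ≤ σ') ∧
  caTraj f ξ τ = ξ ∧
  (∀ τ' : ℕ, 0 < τ' → caTraj f ξ τ' = ξ → τ ≤ τ')

/-- `η` is a proper initial configuration for the periodic solution `ξ`:
it agrees with `ξ` at all sites `≤ y` for some `y`. -/
def IsProper {n : ℕ} (ξ η : ℤ → Fin n) : Prop :=
  ∃ y : ℤ, ∀ x ≤ y, η x = ξ x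

/-- The periodic solution `ξ` of `f` is weakly robust: the expansion velocity is
positive, i.e. there is `v > 0` such that for every proper initial configuration
`η`, eventually (in `t`) the two trajectories agree at all sites `x ≤ v·t`
(equivalently, `inf_η liminf_t s_t(η)/t > 0`). -/
def IsWeaklyRobust {n : ℕ} (f : CARule n) (ξ : ℤ → Fin n) : Prop :=
  ∃ v : ℝ, 0 < v ∧ ∀ η : ℤ → Fin n, IsProper ξ η →
    ∀ᶠ t : ℕ in atTop, ∀ x : ℤ, (x : ℝ) ≤ v * t → caTraj f η t x = caTraj f ξ t x

/-- The label (τ-periodic sequence) `A` right-extends to `B` under `f`: `A → B`. -/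
def RightExtends {n : ℕ} (f : CARule n) (A B : ℕ → Fin n) : Prop :=
  ∀ i : ℕ, f (A i) (B i) = B (i + 1)

/-- The sequence `c_{j+1} = f(a_j, c_j)` started at `c₀`. -/
def chaseSeq {n : ℕ} (f : CARule n) (A : ℕ → Fin n) (c₀ : Fin n) : ℕ → Fin n
  | 0 => c₀
  | j + 1 => f (A j) (chaseSeq f A c₀ j)

/-- The label `A` decides `B` under `f`: `A ⇒ B`. -/
def Decides {n : ℕ} (f : CARule n) (A B : ℕ → Fin n) : Prop :=
  RightExtends f A B ∧ ∀ c₀ : Fin n, ∃ j : ℕ, chaseSeq f A c₀ j = B j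

/-- `T` is a (τ,σ)-periodic array (row index mod τ, column index mod σ). -/
def IsTilePeriodic {n : ℕ} (τ σ : ℕ) (T : ℕ → ℕ → Fin n) : Prop :=
  (∀ i j, T (i + τ) j = T i j) ∧ (∀ i j, T i (j + σ) = T i j)

/-- The set of states appearing in the tile `T`. -/
def tileStates (n τ σ : ℕ) (T : ℕ → ℕ → Fin n) : Finset (Fin n) :=
  (Finset.range τ ×ˢ Finset.range σ).image fun p => T p.1 p.2

/-- The set of horizontally adjacent pairs appearing in the tile `T`. -/
def tilePairs (n τ σ : ℕ) (T : ℕ → ℕ → Fin n) : Finset (Fin n × Fin n) :=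
  (Finset.range τ ×ˢ Finset.range σ).image fun p => (T p.1 p.2, T p.1 (p.2 + 1))

/-- `T` is a tile of a periodic solution: uniqueness of assignment, each row has
minimal period `σ`, and the cyclic sequence of rows has minimal period `τ`. -/
def IsPSTile (n τ σ : ℕ) (T : ℕ → ℕ → Fin n) : Prop :=
  IsTilePeriodic τ σ T ∧
  (∀ i j k m, T i j = T k m → T i (j + 1) = T k (m + 1) →
      T (i + 1) (j + 1) = T (k + 1) (m + 1)) ∧
  (∀ i : ℕ, ∀ σ' : ℕ, 0 < σ' → (∀ j, T i (j + σ') = T i j) → σ ≤ σ') ∧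
  (∀ τ' : ℕ, 0 < τ' → (∀ i j, T (i + τ') j = T i j) → τ ≤ τ')

/-- `T` is a tile of a periodic solution of the given rule `f`. -/
def IsPSTileOf {n : ℕ} (f : CARule n) (τ σ : ℕ) (T : ℕ → ℕ → Fin n) : Prop :=
  IsTilePeriodic τ σ T ∧
  (∀ i j, f (T i j) (T i (j + 1)) = T (i + 1) (j + 1)) ∧
  (∀ i : ℕ, ∀ σ' : ℕ, 0 < σ' → (∀ j, T i (j + σ') = T i j) → σ ≤ σ') ∧
  (∀ τ' : ℕ, 0 < τ' → (∀ i j, T (i + τ') j = T i j) → τ ≤ τ')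

/-- `T` is simple: the assignment number `p(T)` equals the number of states `s(T)`. -/
def IsSimpleTile (n τ σ : ℕ) (T : ℕ → ℕ → Fin n) : Prop :=
  (tilePairs n τ σ T).card = (tileStates n τ σ T).card

/-- The rank of a tile: the largest `x` such that some `x` columns of `T`
together contain `x * τ` pairwise distinct states. -/
noncomputable def tileRank (n τ σ : ℕ) (T : ℕ → ℕ → Fin n) : ℕ :=
  sSup {x : ℕ | ∃ J : Finset ℕ, J ⊆ Finset.range σ ∧ J.card = x ∧
    ((J ×ˢ Finset.range τ).image fun p => T p.2 p.1).card = x * τ}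

/-- The tile of the periodic solution `ξ` of `f`: `a_{i,j} = ξ_i(j)`. -/
def psTile {n : ℕ} (f : CARule n) (ξ : ℤ → Fin n) : ℕ → ℕ → Fin n :=
  fun i j => caTraj f ξ i (j : ℤ)

/-- The proportion of `n`-state rules with the property `p`. -/
noncomputable def ruleDensity {n : ℕ} (p : CARule n → Prop) : ℝ :=
  (Nat.card {f : CARule n // p f} : ℝ) / (n : ℝ) ^ (n ^ 2)

open Classical in
lemma ruleDensity_eq_sum {n : ℕ} (p : CARule n → Prop) :
    ruleDensity p = (∑ f : CARule n, if p f then (1 : ℝ) else 0) / (n : ℝ) ^ (n ^ 2) := by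
  rw [ruleDensity, Nat.card_eq_fintype_card, Fintype.card_subtype, Finset.sum_boole]

lemma ruleDensity_nonneg {n : ℕ} (p : CARule n → Prop) : 0 ≤ ruleDensity p := by
  unfold ruleDensity; positivity

lemma ruleDensity_mono {n : ℕ} {p q : CARule n → Prop} (h : ∀ f, p f → q f) :
    ruleDensity p ≤ ruleDensity q := by
  unfold ruleDensity
  gcongr
  exact Nat.card_le_card_of_injective (Subtype.map id h) (Subtype.map_injective _ Function.injective_id)

lemma ruleDensity_of_forall_not {n : ℕ} {p : CARule n → Prop} (h : ∀ f, ¬ p f) :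
    ruleDensity p = 0 := by
  have : IsEmpty {f // p f} := ⟨fun f => h f.1 f.2⟩
  simp [ruleDensity]

/-- Distinct entries of a uniform random rule are independent and uniform. -/
lemma ruleDensity_comp {n : ℕ} (hn : 0 < n) {V : Type*} [Fintype V]
    (e : V → Fin n × Fin n) (he : Function.Injective e) (S : (V → Fin n) → Prop) :
    ruleDensity (fun f => S fun v => f (e v).1 (e v).2) =
      (Nat.card {φ : V → Fin n // S φ} : ℝ) / (n : ℝ) ^ Fintype.card V := by
  classical
  let E₁ : CARule n ≃ (V → Fin n) × ({x // ¬ x ∈ Set.range e} → Fin n) :=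
    (Equiv.curry (Fin n) (Fin n) (Fin n)).symm.trans <|
      (Equiv.piEquivPiSubtypeProd (fun x => x ∈ Set.range e) (fun _ => Fin n)).trans <|
        Equiv.prodCongr (Equiv.arrowCongr (Equiv.ofInjective e he).symm (Equiv.refl _))
          (Equiv.refl _)
  have hE : ∀ f, (E₁ f).1 = fun v => f (e v).1 (e v).2 := by
    intro f; rfl
  have E₂ : {f : CARule n // S fun v => f (e v).1 (e v).2} ≃
      {φ : V → Fin n // S φ} × ({x // ¬ x ∈ Set.range e} → Fin n) :=
    (E₁.subtypeEquiv (q := fun y => S y.1) (fun f => by rw [hE])).trans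
      (Equiv.prodSubtypeFstEquivSubtypeProd)
  have hc : Nat.card ({x // ¬ x ∈ Set.range e} → Fin n) = n ^ (n ^ 2 - Fintype.card V) := by
    rw [Nat.card_fun, Nat.card_eq_fintype_card, Nat.card_eq_fintype_card,
      Fintype.card_subtype_compl, Fintype.card_prod, Fintype.card_fin]
    congr 2
    · ring
    · exact (Fintype.card_congr (Equiv.ofInjective e he)).symm
  have hV : Fintype.card V ≤ n ^ 2 := by
    have := Fintype.card_le_of_injective e he
    simpa [sq] using this
  rw [ruleDensity, Nat.card_congr E₂, Nat.card_prod, hc]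
  have : (n : ℝ) ≠ 0 := by positivity
  rw [div_eq_div_iff (by positivity) (by positivity)]
  push_cast
  rw [mul_assoc, ← pow_add, Nat.sub_add_cancel hV]

lemma ruleDensity_le_of_agree {n : ℕ} (hn : 0 < n) (D : Finset (Fin n × Fin n))
    (p : CARule n → Prop)
    (h : ∀ f g, p f → p g → ∀ d ∈ D, f d.1 d.2 = g d.1 d.2) :
    ruleDensity p ≤ (n : ℝ)⁻¹ ^ D.card := by
  classical
  by_cases hp : ∃ f₀, p f₀
  · obtain ⟨f₀, h₀⟩ := hp
    have := ruleDensity_comp hn (fun d : D => d.1) Subtype.val_injective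
      (fun φ => φ = fun d => f₀ d.1.1 d.1.2)
    refine (ruleDensity_mono (q := fun f => (fun d : D => f d.1.1 d.1.2) =
      fun d => f₀ d.1.1 d.1.2) ?_).trans (this.trans ?_).le
    · intro f hf
      ext1 d
      exact h f f₀ hf h₀ d d.2
    · simp [inv_pow]
  · rw [ruleDensity_of_forall_not (by simpa using hp)]
    positivity

/-- Summing `n ^ (-#image)` over all maps from a fixed finite type is bounded. -/
lemma sum_inv_pow_card_image_le (ι : Type*) [Fintype ι] [DecidableEq ι] {n : ℕ} (hn : 0 < n) :
    ∑ g : ι → Fin n, (n : ℝ)⁻¹ ^ (Finset.univ.image g).card ≤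
      (Fintype.card (ι → ι) : ℝ) := by
  classical
  have key : ∀ g : ι → Fin n, ∃ π : ι → ι, g ∘ π = g ∧
      (Finset.univ.image g).card = (Finset.univ.image π).card := by
    intro g
    have hr : ∀ i, ∃ j, g j = g i := fun i => ⟨i, rfl⟩
    have hr' : ∀ y : Set.range g, ∃ j, g j = y := fun y => y.2
    choose s hs using hr'
    refine ⟨fun i => s ⟨g i, i, rfl⟩, funext fun i => hs _, ?_⟩
    have : Finset.univ.image g = (Finset.univ.image fun i => s ⟨g i, i, rfl⟩).image g := by
      rw [Finset.image_image]
      congr 1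
      exact (funext fun i => (hs ⟨g i, i, rfl⟩).symm)
    rw [this]
    apply Finset.card_image_of_injOn
    intro a ha b hb hab
    simp only [Finset.coe_image, Set.mem_image, Finset.coe_univ, Set.mem_univ, true_and] at ha hb
    obtain ⟨i, rfl⟩ := ha
    obtain ⟨j, rfl⟩ := hb
    simp only [hs] at hab
    simp only [hab]
  choose π h1 h2 using key
  calc ∑ g : ι → Fin n, (n : ℝ)⁻¹ ^ (Finset.univ.image g).card
      = ∑ ρ : ι → ι, ∑ g : ι → Fin n with π g = ρ, (n : ℝ)⁻¹ ^ (Finset.univ.image g).card :=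
        (Finset.sum_fiberwise _ _ _).symm
    _ ≤ ∑ ρ : ι → ι, (1 : ℝ) := by
        refine Finset.sum_le_sum fun ρ _ => ?_
        have hcard : (Finset.univ.filter fun g : ι → Fin n => π g = ρ).card ≤
            n ^ (Finset.univ.image ρ).card := by
          have : n ^ (Finset.univ.image ρ).card = Fintype.card ((Finset.univ.image ρ) → Fin n) := by
            rw [Fintype.card_fun, Fintype.card_fin, Fintype.card_coe]
          rw [this, ← Fintype.card_coe]
          refine Fintype.card_le_of_injective
            (fun g => fun i : Finset.univ.image ρ => g.1 i.1) ?_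
          rintro ⟨g, hg⟩ ⟨g', hg'⟩ hgg
          simp only [Finset.mem_filter, Finset.mem_univ, true_and] at hg hg'
          simp only [Subtype.mk.injEq]
          rw [← h1 g, ← h1 g', hg, hg']
          ext1 i
          exact congrFun hgg ⟨ρ i, Finset.mem_image_of_mem _ (Finset.mem_univ _)⟩
        have hconst : ∀ g ∈ (Finset.univ.filter fun g : ι → Fin n => π g = ρ),
            (n : ℝ)⁻¹ ^ (Finset.univ.image g).card = (n : ℝ)⁻¹ ^ (Finset.univ.image ρ).card := by
          intro g hg
          rw [h2, (Finset.mem_filter.1 hg).2]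
        rw [Finset.sum_congr rfl hconst, Finset.sum_const, nsmul_eq_mul]
        have hn' : (0 : ℝ) < n := by exact_mod_cast hn
        rw [inv_pow, ← div_eq_mul_inv, div_le_one (by positivity)]
        exact_mod_cast hcard
    _ = _ := by simp

lemma sum_sum_inv_pow_card_image_union_le (α β : Type*) [Fintype α] [DecidableEq α]
    [Fintype β] [DecidableEq β] {n : ℕ} (hn : 0 < n) :
    ∑ x : α → Fin n, ∑ y : β → Fin n,
      (n : ℝ)⁻¹ ^ (Finset.univ.image x ∪ Finset.univ.image y).card ≤
      (Fintype.card (α ⊕ β → α ⊕ β) : ℝ) := by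
  refine le_trans (le_of_eq ?_) (sum_inv_pow_card_image_le (α ⊕ β) hn)
  rw [← Fintype.sum_prod_type', ← (Equiv.sumArrowEquivProdArrow α β (Fin n)).symm.sum_comp]
  refine Finset.sum_congr rfl fun p _ => ?_
  congr 2
  ext y
  simp only [Finset.mem_union, Finset.mem_image, Finset.mem_univ, true_and, Sum.exists]
  exact Iff.rfl

section LayeredMaps

variable {Λ : Type*} [Fintype Λ] [DecidableEq Λ] {n : ℕ}

/-- One step of the layered map on `Λ × Fin n` moving layer `l` to layer `π l` along `φ`. -/
def layerStep (π : Λ → Λ) (φ : Λ × Fin n → Fin n) (v : Λ × Fin n) : Λ × Fin n :=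
  (π v.1, φ v)

/-- Every point is eventually absorbed by the invariant section `b` of the layered map. -/
def IsAbsorbing (π : Λ → Λ) (b : Λ → Fin n) (φ : Λ × Fin n → Fin n) : Prop :=
  (∀ l, φ (l, b l) = b (π l)) ∧
    ∀ v, ∃ m : ℕ, ((layerStep π φ)^[m] v).2 = b ((layerStep π φ)^[m] v).1

/-- A row of a matrix whose determinant is the indicator of `IsAbsorbing`. -/
noncomputable def absorbRow (π : Λ → Λ) (b : Λ → Fin n) (v : Λ × Fin n) (y : Fin n)
    (u : Λ × Fin n) : ℝ :=
  if v.2 = b v.1 then (if y = b (π v.1) then (if v = u then 1 else 0) else 0)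
  else (if v = u then 1 else 0) -
    (if y = b (π v.1) then 0 else (if u = (π v.1, y) then 1 else 0))

lemma det_absorbRow_of_isAbsorbing {π : Λ → Λ} {b : Λ → Fin n} {φ : Λ × Fin n → Fin n}
    (h : IsAbsorbing π b φ) :
    (Matrix.of fun v => absorbRow π b v (φ v)).det = 1 := by
  obtain ⟨h1, h2⟩ := h
  set s := layerStep π φ with hs
  have habs : ∀ v, v.2 = b v.1 → (s v).2 = b (s v).1 := by
    rintro ⟨l, x⟩ hv
    simp only at hv
    subst hv
    exact h1 l
  have habs' : ∀ k v, v.2 = b v.1 → (s^[k] v).2 = b (s^[k] v).1 := by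
    intro k
    induction k with
    | zero => exact fun v hv => hv
    | succ k ih => intro v hv; rw [Function.iterate_succ_apply]; exact ih _ (habs v hv)
  let A : Matrix (Λ × Fin n) (Λ × Fin n) ℝ :=
    Matrix.of fun v u => if (s v).2 ≠ b (s v).1 ∧ u = s v then 1 else 0
  have hM : (Matrix.of fun v => absorbRow π b v (φ v)) = 1 - A := by
    ext v u
    simp only [Matrix.of_apply, absorbRow, Matrix.sub_apply, Matrix.one_apply, A]
    by_cases hv : v.2 = b v.1
    · have h3 := habs v hv
      have h4 : φ v = b (π v.1) := h3
      simp [hv, h3, h4]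
    · simp only [hv, if_false, hs, layerStep]
      by_cases h4 : φ v = b (π v.1) <;> simp [h4]
  have hpow : ∀ m, A ^ (m + 1) = Matrix.of fun v u =>
      if (s^[m + 1] v).2 ≠ b (s^[m + 1] v).1 ∧ u = s^[m + 1] v then 1 else 0 := by
    intro m
    induction m with
    | zero => simp [A]
    | succ m ih =>
      rw [pow_succ', ih]
      ext v u
      simp only [Matrix.mul_apply, A, Matrix.of_apply]
      rw [Finset.sum_eq_single (s v)]
      · by_cases h5 : (s v).2 = b (s v).1
        · have := habs' (m + 1) _ h5
          have hne : ¬ ((s^[m + 1] (s v)).2 ≠ b (s^[m + 1] (s v)).1 ∧ u = s^[m + 1] (s v)) :=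
            fun h => h.1 this
          rw [Function.iterate_succ_apply s (m + 1), if_neg hne]
          simp [h5]
        · rw [Function.iterate_succ_apply s (m + 1)]
          simp [h5]
      · intro w _ hw
        simp [hw]
      · simp
  choose m hm using h2
  have hnil : IsNilpotent A := by
    refine ⟨(∑ v, m v) + 1, ?_⟩
    rw [hpow]
    ext v u
    have hle : m v ≤ (∑ v, m v) + 1 :=
      (Finset.single_le_sum (fun _ _ => Nat.zero_le _) (Finset.mem_univ v)).trans (Nat.le_succ _)
    obtain ⟨k, hk⟩ := Nat.exists_eq_add_of_le' hle
    have := habs' k _ (hm v)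
    rw [← Function.iterate_add_apply, ← hk] at this
    simp only [Matrix.of_apply, Matrix.zero_apply, ite_eq_right_iff]
    exact fun h => absurd this h.1
  have hchar := (Matrix.isNilpotent_charpoly_sub_pow_of_isNilpotent hnil).eq_zero
  rw [hM]
  have := Matrix.eval_charpoly A 1
  rw [sub_eq_zero.1 hchar] at this
  simpa using this.symm

lemma det_absorbRow_of_not_isAbsorbing {π : Λ → Λ} {b : Λ → Fin n} {φ : Λ × Fin n → Fin n}
    (h : ¬ IsAbsorbing π b φ) :
    (Matrix.of fun v => absorbRow π b v (φ v)).det = 0 := by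
  classical
  by_cases h1 : ∀ l, φ (l, b l) = b (π l)
  · have h2 : ∃ v, ∀ m : ℕ, ((layerStep π φ)^[m] v).2 ≠ b ((layerStep π φ)^[m] v).1 := by
      by_contra hcon
      push Not at hcon
      exact h ⟨h1, hcon⟩
    set s := layerStep π φ with hs
    have habs : ∀ v, v.2 = b v.1 → (s v).2 = b (s v).1 := by
      rintro ⟨l, x⟩ hv
      simp only at hv
      subst hv
      exact h1 l
    obtain ⟨v₀, hv₀⟩ := h2
    rw [← Matrix.exists_mulVec_eq_zero_iff]
    let Ω : Λ × Fin n → Prop := fun v => ∀ m : ℕ, (s^[m] v).2 ≠ b (s^[m] v).1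
    have hΩ : ∀ v, Ω (s v) ↔ Ω v := by
      intro v
      constructor
      · intro hv m hm
        apply hv m
        rw [← Function.iterate_succ_apply, Function.iterate_succ_apply']
        exact habs _ hm
      · intro hv m
        rw [← Function.iterate_succ_apply]
        exact hv (m + 1)
    refine ⟨fun v => if Ω v then 1 else 0, fun h0 => ?_, ?_⟩
    · have := congrFun h0 v₀
      simp [Ω, hv₀] at this
    · ext v
      simp only [Matrix.mulVec, dotProduct, Matrix.of_apply, absorbRow, Pi.zero_apply]
      by_cases hv : v.2 = b v.1
      · have : ¬ Ω v := fun hh => hh 0 hv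
        refine Finset.sum_eq_zero fun x _ => ?_
        by_cases hx : v = x
        · subst hx; simp [this]
        · simp [hv, hx]
      · have h3 := hΩ v
        by_cases h4 : φ v = b (π v.1)
        · have : ¬ Ω (s v) := fun hh => hh 0 h4
          rw [h3] at this
          refine Finset.sum_eq_zero fun x _ => ?_
          by_cases hx : v = x
          · subst hx; simp [this]
          · simp [hv, h4, hx]
        · simp only [hv, h4, if_false, sub_mul, ite_mul, one_mul, zero_mul,
            Finset.sum_sub_distrib, Finset.sum_ite_eq, Finset.sum_ite_eq', Finset.mem_univ, if_true]
          have h5 : Ω (π v.1, φ v) ↔ Ω v := h3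
          simp [h5]
  · push Not at h1
    obtain ⟨l, hl⟩ := h1
    refine Matrix.det_eq_zero_of_row_eq_zero (l, b l) fun u => ?_
    simp [absorbRow, hl]

/-- The transition matrix of `π`. -/
def funMatrix (π : Λ → Λ) : Matrix Λ Λ ℝ := Matrix.of fun l k => if k = π l then 1 else 0

lemma card_isAbsorbing (hn : 0 < n) (π : Λ → Λ) (b : Λ → Fin n) :
    (Nat.card {φ : Λ × Fin n → Fin n // IsAbsorbing π b φ} : ℝ) =
      (n : ℝ) ^ (Fintype.card Λ * (n - 1)) *
        (1 - (1 - (n : ℝ)⁻¹) • funMatrix π).det := by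
  classical
  have hn' : (n : ℝ) ≠ 0 := by positivity
  have hsum : (Nat.card {φ : Λ × Fin n → Fin n // IsAbsorbing π b φ} : ℝ) =
      (Matrix.of fun v => ∑ y, absorbRow π b v y).det := by
    have h1 := (Matrix.detRowAlternating (R := ℝ)
      (n := Λ × Fin n)).toMultilinearMap.map_sum (fun v (y : Fin n) => absorbRow π b v y)
    have h2 : (Matrix.of fun v => ∑ y, absorbRow π b v y).det =
      ∑ φ : Λ × Fin n → Fin n, (Matrix.of fun v => absorbRow π b v (φ v)).det := h1
    rw [h2, Nat.card_eq_fintype_card, Fintype.card_subtype, ← Finset.sum_boole]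
    refine Finset.sum_congr rfl fun φ _ => ?_
    split_ifs with h
    · exact (det_absorbRow_of_isAbsorbing h).symm
    · exact (det_absorbRow_of_not_isAbsorbing h).symm
  let d : Λ × Fin n → ℝ := fun v => if v.2 = b v.1 then 1 else n
  let U : Matrix (Λ × Fin n) Λ ℝ := Matrix.of fun v k =>
    if k = π v.1 then (if v.2 = b v.1 then 0 else (n : ℝ)⁻¹) else 0
  let W : Matrix Λ (Λ × Fin n) ℝ := Matrix.of fun k u =>
    if u.1 = k then (if u.2 = b k then 0 else 1) else 0
  have hfac : (Matrix.of fun v => ∑ y, absorbRow π b v y) = Matrix.diagonal d * (1 - U * W) := by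
    ext v u
    rw [Matrix.diagonal_mul]
    simp only [Matrix.sub_apply, Matrix.mul_apply, Matrix.of_apply, U, W, Matrix.one_apply, d,
      ite_mul, zero_mul, Finset.sum_ite_eq', Finset.mem_univ, if_true, Finset.sum_apply]
    by_cases hv : v.2 = b v.1
    · simp [absorbRow, hv]
    · simp only [absorbRow, hv, if_false, Finset.sum_sub_distrib, Finset.sum_const,
        Finset.card_univ, Fintype.card_fin, nsmul_eq_mul, mul_sub]
      congr 1
      simp only [mul_ite, mul_zero, mul_one, mul_inv_cancel₀ hn']
      by_cases hu : u.1 = π v.1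
      · rw [Finset.sum_eq_single u.2]
        · have : u = (π v.1, u.2) := Prod.ext hu rfl
          simp [hu, ← this]
        · intro y _ hy
          have : u ≠ (π v.1, y) := fun h => hy (by rw [h])
          simp [this]
        · simp
      · have : ∀ y, u ≠ (π v.1, y) := fun y h => hu (by rw [h])
        simp [hu, this]
  have hWU : W * U = (1 - (n : ℝ)⁻¹) • funMatrix π := by
    ext l k
    simp only [Matrix.mul_apply, W, U, Matrix.of_apply, Matrix.smul_apply, funMatrix, smul_eq_mul,
      Fintype.sum_prod_type]
    rw [Finset.sum_eq_single l]
    · by_cases hk : k = π l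
      · simp only [hk, if_true, ite_mul, zero_mul, one_mul, mul_one]
        have : ∀ x : Fin n, (if x = b l then (0:ℝ) else if x = b l then 0 else (n:ℝ)⁻¹) =
            (n:ℝ)⁻¹ - if x = b l then (n:ℝ)⁻¹ else 0 := by
          intro x; split_ifs <;> simp
        simp only [this, Finset.sum_sub_distrib, Finset.sum_ite_eq', Finset.mem_univ, if_true]
        simp [hn']
      · simp [hk]
    · intro k' _ hk'
      simp [hk']
    · simp
  have hd : ∏ v, d v = (n : ℝ) ^ (Fintype.card Λ * (n - 1)) := by
    simp only [d, Fintype.prod_prod_type]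
    have : ∀ l : Λ, (∏ x : Fin n, if x = b l then (1 : ℝ) else n) = (n : ℝ) ^ (n - 1) := by
      intro l
      rw [Finset.prod_ite]
      simp [Finset.filter_ne', Finset.card_erase_of_mem]
    simp [this, ← pow_mul, mul_comm]
  rw [hsum, hfac, Matrix.det_mul, Matrix.det_diagonal, hd, Matrix.det_one_sub_mul_comm, hWU]

end LayeredMaps

/-- The determinant governing absorption along a cycle of `τ` layers. -/
noncomputable def cycleDet (τ : ℕ) [NeZero τ] (x : ℝ) : ℝ :=
  (1 - (1 - x) • funMatrix fun i : ZMod τ => i + 1).det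

lemma exists_tendsto_mul_cycleDet (τ : ℕ) [NeZero τ] :
    ∃ c : ℝ, Tendsto (fun n : ℕ => (n : ℝ) * cycleDet τ (n : ℝ)⁻¹) atTop (nhds c) := by
  have h0 : cycleDet τ 0 = 0 := by
    rw [cycleDet, ← Matrix.exists_mulVec_eq_zero_iff]
    refine ⟨fun _ => 1, fun h => one_ne_zero (congrFun h 0), ?_⟩
    ext i
    simp [Matrix.mulVec, dotProduct, funMatrix, Matrix.one_apply]
  have hd : Differentiable ℝ (cycleDet τ) := by
    unfold cycleDet
    simp only [Matrix.det_apply, Matrix.sub_apply, Matrix.smul_apply, smul_eq_mul, zsmul_eq_mul,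
      Units.smul_def]
    fun_prop
  have hs := (hd 0).hasDerivAt.tendsto_slope_zero
  refine ⟨deriv (cycleDet τ) 0, ?_⟩
  have hn : Tendsto (fun n : ℕ => (n : ℝ)⁻¹) atTop (nhdsWithin 0 {0}ᶜ) := by
    refine tendsto_nhdsWithin_iff.2 ⟨tendsto_inv_atTop_nhds_zero_nat, ?_⟩
    filter_upwards [eventually_gt_atTop 0] with n hn
    simp [hn.ne']
  refine (hs.comp hn).congr fun n => ?_
  simp [h0]

lemma layerStep_iterate {τ : ℕ} {κ : Type*} {n : ℕ} (f : CARule n) (a : ZMod τ × κ → Fin n)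
    (i : ZMod τ) (k : κ) (c : Fin n) (m : ℕ) :
    (layerStep (fun l : ZMod τ × κ => (l.1 + 1, l.2)) (fun v => f (a v.1) v.2))^[m] ((i, k), c) =
      ((i + m, k), chaseSeq f (fun j => a (i + j, k)) c m) := by
  induction m with
  | zero => simp [chaseSeq]
  | succ m ih =>
    rw [Function.iterate_succ_apply', ih]
    simp [layerStep, chaseSeq, add_assoc]

/-- The probability that several disjoint columns of distinct states all decide prescribed
columns. -/
lemma ruleDensity_decides {τ : ℕ} [NeZero τ] {κ : Type*} [Fintype κ] [DecidableEq κ] {n : ℕ}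
    (hn : 0 < n) (a : ZMod τ × κ → Fin n) (ha : Function.Injective a) (b : ZMod τ × κ → Fin n) :
    ruleDensity (fun f => (∀ l, f (a l) (b l) = b (l.1 + 1, l.2)) ∧
      ∀ k c, ∃ m : ℕ, chaseSeq f (fun j => a (j, k)) c m = b (m, k)) =
    (n : ℝ)⁻¹ ^ (τ * Fintype.card κ) * cycleDet τ (n : ℝ)⁻¹ ^ Fintype.card κ := by
  let π : ZMod τ × κ → ZMod τ × κ := fun l => (l.1 + 1, l.2)
  let e : (ZMod τ × κ) × Fin n → Fin n × Fin n := fun v => (a v.1, v.2)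
  have he : Function.Injective e := by
    rintro ⟨l, x⟩ ⟨l', x'⟩ h
    simp only [e, Prod.mk.injEq] at h
    rw [ha h.1, h.2]
  have h1 := ruleDensity_comp hn e he (IsAbsorbing π b)
  have h2 : (fun f : CARule n => (∀ l, f (a l) (b l) = b (l.1 + 1, l.2)) ∧
      ∀ k c, ∃ m : ℕ, chaseSeq f (fun j => a (j, k)) c m = b (m, k)) =
      fun f => IsAbsorbing π b fun v => f (e v).1 (e v).2 := by
    funext f
    refine propext (and_congr Iff.rfl ⟨fun h v => ?_, fun h k c => ?_⟩)
    · obtain ⟨⟨i, k⟩, c⟩ := v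
      have h3 := layerStep_iterate f a i k c (-i).val
      rw [ZMod.natCast_zmod_val, add_neg_cancel] at h3
      obtain ⟨m, hm⟩ := h k (chaseSeq f (fun j => a (i + j, k)) c (-i).val)
      refine ⟨m + (-i).val, ?_⟩
      change ((layerStep (fun l : ZMod τ × κ => (l.1 + 1, l.2))
        (fun v => f (a v.1) v.2))^[m + (-i).val] ((i, k), c)).2 = b ((layerStep
          (fun l : ZMod τ × κ => (l.1 + 1, l.2))
            (fun v => f (a v.1) v.2))^[m + (-i).val] ((i, k), c)).1
      rw [Function.iterate_add_apply, h3, layerStep_iterate]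
      simpa using hm
    · obtain ⟨m, hm⟩ := h ((0, k), c)
      refine ⟨m, ?_⟩
      change ((layerStep (fun l : ZMod τ × κ => (l.1 + 1, l.2))
        (fun v => f (a v.1) v.2))^[m] ((0, k), c)).2 = b ((layerStep
          (fun l : ZMod τ × κ => (l.1 + 1, l.2))
            (fun v => f (a v.1) v.2))^[m] ((0, k), c)).1 at hm
      rw [layerStep_iterate] at hm
      simpa using hm
  have h3 : (1 - (1 - (n : ℝ)⁻¹) • funMatrix π).det = cycleDet τ (n : ℝ)⁻¹ ^ Fintype.card κ := by
    have : 1 - (1 - (n : ℝ)⁻¹) • funMatrix π = Matrix.blockDiagonal fun _ : κ =>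
        1 - (1 - (n : ℝ)⁻¹) • funMatrix fun i : ZMod τ => i + 1 := by
      ext ⟨i, k⟩ ⟨i', k'⟩
      by_cases hk : k = k'
      · simp [Matrix.blockDiagonal_apply, funMatrix, π, hk, Matrix.one_apply]
      · simp [Matrix.blockDiagonal_apply, funMatrix, π, hk, Ne.symm hk]
    rw [this, Matrix.det_blockDiagonal]
    simp [cycleDet]
  have hn' : (n : ℝ) ≠ 0 := by positivity
  rw [h2, h1, card_isAbsorbing hn, h3]
  simp only [Fintype.card_prod, ZMod.card, Fintype.card_fin]
  obtain ⟨p, rfl⟩ := Nat.exists_eq_succ_of_ne_zero hn.ne'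
  rw [inv_pow, Nat.succ_sub_one, Nat.succ_eq_add_one, mul_add, pow_add, mul_one]
  field_simp

/-- The mean of a real function of a uniform random rule. -/
noncomputable def ruleMean {n : ℕ} (g : CARule n → ℝ) : ℝ :=
  (∑ f, g f) / (n : ℝ) ^ (n ^ 2)

lemma ruleMean_ite {n : ℕ} (p : CARule n → Prop) {inst : ∀ f, Decidable (p f)} :
    ruleMean (fun f => if p f then 1 else 0) = ruleDensity p := by
  rw [ruleMean, ruleDensity_eq_sum]
  congr! 3

lemma ruleMean_mono {n : ℕ} {g h : CARule n → ℝ} (hgh : ∀ f, g f ≤ h f) :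
    ruleMean g ≤ ruleMean h := by
  unfold ruleMean
  gcongr with f
  exact hgh f

lemma ruleMean_add {n : ℕ} (g h : CARule n → ℝ) :
    ruleMean (fun f => g f + h f) = ruleMean g + ruleMean h := by
  simp [ruleMean, Finset.sum_add_distrib, add_div]

lemma ruleMean_mul_left {n : ℕ} (c : ℝ) (g : CARule n → ℝ) :
    ruleMean (fun f => c * g f) = c * ruleMean g := by
  simp [ruleMean, ← Finset.mul_sum, mul_div_assoc]

lemma ruleMean_sum {n : ℕ} {I : Type*} (s : Finset I) (g : I → CARule n → ℝ) :
    ruleMean (fun f => ∑ i ∈ s, g i f) = ∑ i ∈ s, ruleMean (g i) := by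
  simp only [ruleMean]
  rw [Finset.sum_comm, Finset.sum_div]

section Cycles

variable {n N N' : ℕ}

/-- The rule moves `x` around the cycle when reading the word `w` on the left. -/
def CycleSat (f : CARule n) (w x : ZMod N → Fin n) : Prop :=
  ∀ j, f (w j) (x j) = x (j + 1)

open Classical in
/-- The rule `f` with the entries along the cycle `x` overwritten so that `CycleSat` holds. -/
noncomputable def setCycle (f : CARule n) (w x : ZMod N → Fin n) : CARule n :=
  fun r s => if h : ∃ j, w j = r ∧ x j = s then x (h.choose + 1) else f r s

lemma setCycle_sat (f : CARule n) {w x : ZMod N → Fin n} (hx : Function.Injective x) :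
    CycleSat (setCycle f w x) w x := by
  intro j
  have h : ∃ j', w j' = w j ∧ x j' = x j := ⟨j, rfl, rfl⟩
  rw [setCycle, dif_pos h]
  rw [hx h.choose_spec.2]

lemma setCycle_of_notMem (f : CARule n) {w x : ZMod N → Fin n} (r : Fin n) {s : Fin n}
    (hs : ∀ j, x j ≠ s) : setCycle f w x r s = f r s :=
  dif_neg fun ⟨j, hj⟩ => hs j hj.2

lemma ruleDensity_le_setCycle [NeZero N] (hn : 0 < n) (p : CARule n → Prop)
    (w x : ZMod N → Fin n) :
    (n : ℝ)⁻¹ ^ N * ruleDensity p ≤ ruleDensity fun f' => ∃ f, p f ∧ f' = setCycle f w x := by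
  have hinj : Function.Injective (fun f : {f // p f} =>
      ((⟨setCycle f.1 w x, f.1, f.2, rfl⟩, fun j => f.1 (w j) (x j)) :
        {f' // ∃ f, p f ∧ f' = setCycle f w x} × (ZMod N → Fin n))) := by
    rintro ⟨f, hf⟩ ⟨g, hg⟩ hfg
    simp only [Prod.mk.injEq, Subtype.mk.injEq] at hfg ⊢
    funext r s
    by_cases h : ∃ j, w j = r ∧ x j = s
    · obtain ⟨j, rfl, rfl⟩ := h
      exact congrFun hfg.2 j
    · have := congrFun (congrFun hfg.1 r) s
      simpa [setCycle, h] using this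
  have hc := Nat.card_le_card_of_injective _ hinj
  rw [Nat.card_prod, Nat.card_fun, Nat.card_eq_fintype_card (α := Fin n),
    Nat.card_eq_fintype_card (α := ZMod N), ZMod.card, Fintype.card_fin] at hc
  have hc' : (Nat.card {f // p f} : ℝ) ≤
      Nat.card {f' // ∃ f, p f ∧ f' = setCycle f w x} * (n : ℝ) ^ N := by exact_mod_cast hc
  unfold ruleDensity
  have hn' : (0 : ℝ) < n := by exact_mod_cast hn
  rw [← mul_div_assoc]
  gcongr
  rw [inv_pow, inv_mul_le_iff₀ (by positivity)]
  linarith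

/-- The entries of the rule used along a cycle. -/
def cycleEntries [NeZero N] (w x : ZMod N → Fin n) : Finset (Fin n × Fin n) :=
  Finset.univ.image fun j => (w j, x j)

/-- Two cycles together use more entries than states. -/
def Overfull [NeZero N] [NeZero N'] (w x : ZMod N → Fin n) (w' x' : ZMod N' → Fin n) : Prop :=
  (Finset.univ.image x ∪ Finset.univ.image x').card <
    (cycleEntries w x ∪ cycleEntries w' x').card

lemma image_eq_of_not_overfull [NeZero N] [NeZero N'] {f : CARule n} {w x : ZMod N → Fin n}
    {w' x' : ZMod N' → Fin n} (h : CycleSat f w x) (h' : CycleSat f w' x')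
    (ho : ¬ Overfull w x w' x') {i : ZMod N} {j : ZMod N'} (hij : x i = x' j) :
    Finset.univ.image x = Finset.univ.image x' := by
  have him : (cycleEntries w x ∪ cycleEntries w' x').image Prod.snd =
      Finset.univ.image x ∪ Finset.univ.image x' := by
    simp only [cycleEntries, Finset.image_union, Finset.image_image]
    rfl
  have hinj : Set.InjOn Prod.snd (cycleEntries w x ∪ cycleEntries w' x' : Set (Fin n × Fin n)) := by
    rw [← Finset.coe_union]
    apply Finset.injOn_of_card_image_eq
    refine le_antisymm Finset.card_image_le ?_
    rw [him]
    exact not_lt.1 ho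
  have hw : ∀ i j, x i = x' j → w i = w' j := by
    intro i j hij
    have h1 : (w i, x i) ∈ (cycleEntries w x ∪ cycleEntries w' x' : Set (Fin n × Fin n)) :=
      Or.inl (Finset.mem_coe.2 (Finset.mem_image_of_mem _ (Finset.mem_univ i)))
    have h2 : (w' j, x' j) ∈ (cycleEntries w x ∪ cycleEntries w' x' : Set (Fin n × Fin n)) :=
      Or.inr (Finset.mem_coe.2 (Finset.mem_image_of_mem _ (Finset.mem_univ j)))
    exact congrArg Prod.fst (hinj h1 h2 hij)
  have hm : ∀ m : ℕ, x (i + m) = x' (j + m) := by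
    intro m
    induction m with
    | zero => simpa using hij
    | succ m ih =>
      push_cast
      rw [← add_assoc, ← add_assoc, ← h, ← h', ih, hw _ _ ih]
  apply Finset.Subset.antisymm
  · intro y hy
    obtain ⟨i', -, rfl⟩ := Finset.mem_image.1 hy
    have := hm (i' - i).val
    rw [ZMod.natCast_zmod_val, add_sub_cancel] at this
    rw [this]
    exact Finset.mem_image_of_mem _ (Finset.mem_univ _)
  · intro y hy
    obtain ⟨j', -, rfl⟩ := Finset.mem_image.1 hy
    have := hm (j' - j).val
    rw [ZMod.natCast_zmod_val, add_sub_cancel] at this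
    rw [← this]
    exact Finset.mem_image_of_mem _ (Finset.mem_univ _)

lemma CycleSat.ext_zero [NeZero N] {f : CARule n} {w x y : ZMod N → Fin n} (hx : CycleSat f w x)
    (hy : CycleSat f w y) (h : x 0 = y 0) : x = y := by
  have hm : ∀ m : ℕ, x m = y m := by
    intro m
    induction m with
    | zero => simpa using h
    | succ m ih => push_cast; rw [← hx, ← hy, ih]
  funext j
  simpa using hm j.val

lemma CycleSat.chaseSeq_eq {f : CARule n} {w x : ZMod N → Fin n} (hx : CycleSat f w x)
    (A : ℕ → Fin n) (hA : ∀ m : ℕ, w m = A m) (m : ℕ) : chaseSeq f A (x 0) m = x m := by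
  induction m with
  | zero => simp [chaseSeq]
  | succ m ih => simp only [chaseSeq, ih, ← hA]; push_cast; exact hx _

end Cycles

lemma eventually_half_le_card_avoiding (N κ : ℕ) [NeZero N] :
    ∀ᶠ n : ℕ in atTop, ∀ K : Finset (Fin n), K.card ≤ κ →
      (1 / 2 : ℝ) ≤ (n : ℝ)⁻¹ ^ N *
        Nat.card {x : ZMod N → Fin n // Function.Injective x ∧ ∀ j, x j ∉ K} := by
  have hlim : Tendsto (fun n : ℕ => (1 - ((κ + N : ℕ) : ℝ) * (n : ℝ)⁻¹) ^ N) atTop (nhds 1) := by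
    have := ((tendsto_inv_atTop_nhds_zero_nat (𝕜 := ℝ)).const_mul ((κ + N : ℕ) : ℝ)).const_sub 1
    simpa using this.pow N
  filter_upwards [hlim.eventually (lt_mem_nhds (by norm_num : (1 / 2 : ℝ) < 1)),
    eventually_gt_atTop (κ + N)] with n hn hgt K hK
  have e : {x : ZMod N → Fin n // Function.Injective x ∧ ∀ j, x j ∉ K} ≃
      (ZMod N ↪ {y // y ∉ K}) :=
    { toFun := fun x => ⟨fun j => ⟨x.1 j, x.2.2 j⟩, fun i j h => x.2.1 (congrArg Subtype.val h)⟩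
      invFun := fun g => ⟨fun j => (g j).1, fun i j h => g.injective (Subtype.ext h),
        fun j => (g j).2⟩
      left_inv := fun x => rfl
      right_inv := fun g => rfl }
  have hc : (n - (κ + N)) ^ N ≤
      Nat.card {x : ZMod N → Fin n // Function.Injective x ∧ ∀ j, x j ∉ K} := by
    rw [Nat.card_congr e, Nat.card_eq_fintype_card, Fintype.card_embedding_eq, ZMod.card]
    have h1 : Fintype.card {y // y ∉ K} = n - K.card := by
      rw [Fintype.card_subtype_compl]; simp
    rw [h1]
    refine le_trans ?_ (Nat.pow_sub_le_descFactorial _ _)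
    exact Nat.pow_le_pow_left (by omega) _
  refine hn.le.trans ?_
  have hn0 : (0 : ℝ) < n := by exact_mod_cast (by omega : 0 < n)
  calc (1 - ((κ + N : ℕ) : ℝ) * (n : ℝ)⁻¹) ^ N
      = (n : ℝ)⁻¹ ^ N * (((n - (κ + N) : ℕ) : ℝ)) ^ N := by
        rw [← mul_pow, Nat.cast_sub hgt.le]
        congr 1
        field_simp
    _ ≤ _ := by
        gcongr
        exact_mod_cast hc

section Lifts

variable {τ n : ℕ}

/-- The word `w` read `k + 1` times around. -/
def liftWord (w : ZMod τ → Fin n) (k : ℕ) : ZMod ((k + 1) * τ) → Fin n :=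
  fun j => w (ZMod.castHom (Dvd.intro_left (k + 1) rfl) (ZMod τ) j)

lemma liftWord_natCast (w : ZMod τ → Fin n) (k m : ℕ) : liftWord w k m = w m := by
  simp [liftWord]

variable [NeZero τ]

/-- Candidate cycles whose length is one of the first `L` multiples of `τ`. -/
abbrev LiftedCycle (τ L n : ℕ) := Σ k : Fin L, (ZMod ((k.val + 1) * τ) → Fin n)

/-- The states of a candidate cycle. -/
def LiftedCycle.states {L : ℕ} (i : LiftedCycle τ L n) : Finset (Fin n) :=
  Finset.univ.image i.2

/-- The entries of a rule read along a candidate cycle. -/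
def LiftedCycle.entries {L : ℕ} (w : ZMod τ → Fin n) (i : LiftedCycle τ L n) :
    Finset (Fin n × Fin n) :=
  cycleEntries (liftWord w i.1.val) i.2

/-- The candidate cycles which are genuine cycles avoiding `K`. -/
def LiftedCycle.Valid {L : ℕ} (K : Finset (Fin n)) (i : LiftedCycle τ L n) : Prop :=
  Function.Injective i.2 ∧ ∀ j, i.2 j ∉ K

/-- Both cycles avoid `K`, are present in `f`, overlap in an overfull way, and `f` agrees
with `f₀` on `C`. -/
def BadPair {L : ℕ} (w : ZMod τ → Fin n) (K : Finset (Fin n)) (C : Finset (Fin n × Fin n))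
    (f₀ : CARule n) (i i' : LiftedCycle τ L n) (f : CARule n) : Prop :=
  i.Valid K ∧ i'.Valid K ∧ CycleSat f (liftWord w i.1.val) i.2 ∧
    CycleSat f (liftWord w i'.1.val) i'.2 ∧
    Overfull (liftWord w i.1.val) i.2 (liftWord w i'.1.val) i'.2 ∧
    ∀ c ∈ C, f c.1 c.2 = f₀ c.1 c.2

lemma ruleDensity_badPair_le {L : ℕ} (hn : 0 < n) (w : ZMod τ → Fin n) (K : Finset (Fin n))
    (C : Finset (Fin n × Fin n)) (hC : ∀ c ∈ C, c.2 ∈ K) (f₀ : CARule n)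
    (i i' : LiftedCycle τ L n) :
    ruleDensity (BadPair w K C f₀ i i') ≤
      (n : ℝ)⁻¹ ^ C.card * ((n : ℝ)⁻¹ * (n : ℝ)⁻¹ ^ (i.states ∪ i'.states).card) := by
  by_cases hb : ∃ f, BadPair w K C f₀ i i' f
  swap
  · rw [ruleDensity_of_forall_not (fun f hf => hb ⟨f, hf⟩)]
    positivity
  obtain ⟨f, hi, hi', -, -, ho, -⟩ := hb
  have hn1 : (1 : ℝ) ≤ n := by exact_mod_cast hn
  have hdisj : Disjoint C (i.entries w ∪ i'.entries w) := by
    rw [Finset.disjoint_left]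
    intro c hc hc'
    have := hC c hc
    simp only [LiftedCycle.entries, cycleEntries, Finset.mem_union, Finset.mem_image,
      Finset.mem_univ, true_and] at hc'
    rcases hc' with ⟨j, rfl⟩ | ⟨j, rfl⟩
    · exact hi.2 j this
    · exact hi'.2 j this
  refine (ruleDensity_le_of_agree hn (C ∪ (i.entries w ∪ i'.entries w)) _ ?_).trans ?_
  · rintro f g ⟨-, -, hf, hf', -, hfC⟩ ⟨-, -, hg, hg', -, hgC⟩ d hd
    simp only [LiftedCycle.entries, cycleEntries, Finset.mem_union, Finset.mem_image,
      Finset.mem_univ, true_and] at hd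
    rcases hd with hd | ⟨j, rfl⟩ | ⟨j, rfl⟩
    · rw [hfC d hd, hgC d hd]
    · exact (hf j).trans (hg j).symm
    · exact (hf' j).trans (hg' j).symm
  · rw [Finset.card_union_of_disjoint hdisj, pow_add, ← pow_succ']
    exact mul_le_mul_of_nonneg_left (pow_le_pow_of_le_one (by positivity)
      (inv_le_one_of_one_le₀ hn1) ho) (by positivity)

open Classical in
lemma sum_weight_setCycle_le {L : ℕ} (w : ZMod τ → Fin n) (K : Finset (Fin n))
    (C : Finset (Fin n × Fin n)) (hC : ∀ c ∈ C, c.2 ∈ K) (f₀ : CARule n) (p : CARule n → Prop)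
    (hpC : ∀ f, p f → ∀ c ∈ C, f c.1 c.2 = f₀ c.1 c.2)
    (hp : ∀ f, p f → ∀ c, ∃ m : ℕ, chaseSeq f (fun j => w j) c m ∈ K) (f' : CARule n) :
    ∑ i : LiftedCycle τ L n with i.Valid K, (1 / ((i.1.val : ℝ) + 1)) *
        (if ∃ f, p f ∧ f' = setCycle f (liftWord w i.1.val) i.2 then 1 else 0) ≤
      τ * (if ∀ c ∈ C, f' c.1 c.2 = f₀ c.1 c.2 then 1 else 0) +
        ∑ i : LiftedCycle τ L n, ∑ i' : LiftedCycle τ L n,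
          (if BadPair w K C f₀ i i' f' then 1 else 0) := by
  set S : Finset (LiftedCycle τ L n) := Finset.univ.filter fun i =>
    i.Valid K ∧ ∃ f, p f ∧ f' = setCycle f (liftWord w i.1.val) i.2 with hS
  have hsum : ∑ i : LiftedCycle τ L n with i.Valid K, (1 / ((i.1.val : ℝ) + 1)) *
      (if ∃ f, p f ∧ f' = setCycle f (liftWord w i.1.val) i.2 then (1 : ℝ) else 0) =
      ∑ i ∈ S, 1 / ((i.1.val : ℝ) + 1) := by
    simp only [mul_ite, mul_one, mul_zero]
    rw [← Finset.sum_filter, Finset.filter_filter]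
  rw [hsum]
  rcases S.eq_empty_or_nonempty with hE | ⟨i₀, hi₀⟩
  · rw [hE, Finset.sum_empty]
    have : ∀ i i' : LiftedCycle τ L n, (0 : ℝ) ≤ if BadPair w K C f₀ i i' f' then 1 else 0 :=
      fun i i' => by split_ifs <;> norm_num
    exact add_nonneg (mul_nonneg (by positivity) (by split_ifs <;> norm_num))
      (Finset.sum_nonneg fun i _ => Finset.sum_nonneg fun i' _ => this i i')
  have hmem : ∀ i ∈ S, i.Valid K ∧ CycleSat f' (liftWord w i.1.val) i.2 := by
    intro i hi
    obtain ⟨hv, f, -, rfl⟩ := (Finset.mem_filter.1 hi).2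
    exact ⟨hv, setCycle_sat f hv.1⟩
  have hagree : ∀ c ∈ C, f' c.1 c.2 = f₀ c.1 c.2 := by
    obtain ⟨hv, f, hf, rfl⟩ := (Finset.mem_filter.1 hi₀).2
    intro c hc
    have hne : ∀ j, i₀.2 j ≠ c.2 := fun j hj => hv.2 j (by rw [hj]; exact hC c hc)
    rw [setCycle_of_notMem f c.1 hne, hpC f hf c hc]
  have hmeet : ∀ i ∈ S, ∃ a b, i.2 a = i₀.2 b := by
    intro i hi
    by_contra! hne
    obtain ⟨hv, hsat⟩ := hmem i hi
    obtain ⟨hv₀, f, hf, rfl⟩ := (Finset.mem_filter.1 hi₀).2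
    have hsat' : CycleSat f (liftWord w i.1.val) i.2 := by
      intro j
      rw [← hsat j, setCycle_of_notMem f _ fun b => (hne j b).symm]
    obtain ⟨m, hm⟩ := hp f hf (i.2 0)
    rw [hsat'.chaseSeq_eq _ (fun m => liftWord_natCast w i.1.val m)] at hm
    exact hv.2 _ hm
  rw [if_pos hagree, mul_one, ← Finset.sum_filter_not_add_sum_filter S fun i =>
    Overfull (liftWord w i₀.1.val) i₀.2 (liftWord w i.1.val) i.2]
  apply add_le_add
  · have hsame : ∀ i ∈ S, ¬ Overfull (liftWord w i₀.1.val) i₀.2 (liftWord w i.1.val) i.2 →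
        i.1 = i₀.1 ∧ i.2 0 ∈ i₀.states := by
      intro i hi ho
      obtain ⟨a, b, hab⟩ := hmeet i hi
      have him := image_eq_of_not_overfull (hmem i₀ hi₀).2 (hmem i hi).2 ho hab.symm
      refine ⟨?_, ?_⟩
      · have := congrArg Finset.card him
        rw [Finset.card_image_of_injective _ (hmem i₀ hi₀).1.1,
          Finset.card_image_of_injective _ (hmem i hi).1.1, Finset.card_univ, Finset.card_univ,
          ZMod.card, ZMod.card] at this
        have := Nat.eq_of_mul_eq_mul_right (NeZero.pos τ) this
        exact Fin.ext (by omega)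
      · rw [LiftedCycle.states, him]
        exact Finset.mem_image_of_mem _ (Finset.mem_univ _)
    set S' := S.filter fun i => ¬ Overfull (liftWord w i₀.1.val) i₀.2 (liftWord w i.1.val) i.2
    have hcard : S'.card ≤ (i₀.1.val + 1) * τ := by
      have hle : i₀.states.card ≤ (i₀.1.val + 1) * τ := by
        refine Finset.card_image_le.trans ?_
        rw [Finset.card_univ, ZMod.card]
      refine le_trans (Finset.card_le_card_of_injOn (fun i => i.2 0) ?_ ?_) hle
      · intro i hi
        have hi := Finset.mem_filter.1 hi
        exact (hsame i hi.1 hi.2).2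
      · intro i hi i' hi' h
        have hi := Finset.mem_filter.1 hi
        have hi' := Finset.mem_filter.1 hi'
        have e : i.1 = i'.1 := (hsame i hi.1 hi.2).1.trans (hsame i' hi'.1 hi'.2).1.symm
        have h1 := (hmem i hi.1).2
        have h2 := (hmem i' hi'.1).2
        clear hi hi'
        obtain ⟨k, x⟩ := i
        obtain ⟨k', x'⟩ := i'
        obtain rfl : k = k' := e
        exact congrArg (Sigma.mk k) (h1.ext_zero h2 h)
    have heq : ∑ i ∈ S', 1 / ((i.1.val : ℝ) + 1) = S'.card * (1 / ((i₀.1.val : ℝ) + 1)) := by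
      rw [← nsmul_eq_mul, ← Finset.sum_const]
      refine Finset.sum_congr rfl fun i hi => ?_
      have hi := Finset.mem_filter.1 hi
      rw [(hsame i hi.1 hi.2).1]
    rw [heq, mul_one_div, div_le_iff₀ (by positivity)]
    have : (S'.card : ℝ) ≤ (i₀.1.val + 1) * τ := by exact_mod_cast hcard
    linarith
  · have hnn : ∀ i i' : LiftedCycle τ L n,
        (0 : ℝ) ≤ if BadPair w K C f₀ i i' f' then 1 else 0 :=
      fun i i' => by split_ifs <;> norm_num
    refine le_trans ?_ (Finset.single_le_sum (f := fun i => ∑ i' : LiftedCycle τ L n,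
      if BadPair w K C f₀ i i' f' then (1 : ℝ) else 0)
      (fun i _ => Finset.sum_nonneg fun i' _ => hnn i i') (Finset.mem_univ i₀))
    refine le_trans (Finset.sum_le_sum fun i hi => ?_)
      (Finset.sum_le_sum_of_subset_of_nonneg (Finset.subset_univ _) fun i' _ _ => hnn i₀ i')
    have hi := Finset.mem_filter.1 hi
    rw [if_pos ⟨(hmem i₀ hi₀).1, (hmem i hi.1).1, (hmem i₀ hi₀).2, (hmem i hi.1).2, hi.2, hagree⟩]
    rw [div_le_one (by positivity)]
    have : (0 : ℝ) ≤ i.1.val := by positivity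
    linarith

end Lifts

/-- Conditionally on the entries in `C`, it is unlikely that a fixed word drives all
states to a small set `K`. -/
lemma ruleDensity_eventually_small (τ κ : ℕ) [NeZero τ] {ε : ℝ} (hε : 0 < ε) :
    ∀ᶠ n : ℕ in atTop, ∀ (w : ZMod τ → Fin n) (K : Finset (Fin n))
      (C : Finset (Fin n × Fin n)) (p : CARule n → Prop), K.card ≤ κ → (∀ c ∈ C, c.2 ∈ K) →
      (∀ f g, p f → p g → ∀ c ∈ C, f c.1 c.2 = g c.1 c.2) →
      (∀ f, p f → ∀ c, ∃ m : ℕ, chaseSeq f (fun j => w j) c m ∈ K) →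
      ruleDensity p ≤ ε * (n : ℝ)⁻¹ ^ C.card := by
  classical
  obtain ⟨L, hL⟩ := (Real.tendsto_sum_range_one_div_nat_succ_atTop.eventually_ge_atTop
    (2 * (τ + 1) / ε)).exists
  set A : ℝ := ∑ k : Fin L, ∑ k' : Fin L,
    (Fintype.card (ZMod ((k.val + 1) * τ) ⊕ ZMod ((k'.val + 1) * τ) →
      ZMod ((k.val + 1) * τ) ⊕ ZMod ((k'.val + 1) * τ)) : ℝ) with hA
  have hhalf := eventually_all.2 fun k : Fin L =>
    eventually_half_le_card_avoiding ((k.val + 1) * τ) κ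
  filter_upwards [hhalf, eventually_gt_atTop 0, eventually_ge_atTop ⌈A⌉₊] with
    n hhalf hn hnA w K C p hK hC hpC hp
  by_cases hf₀ : ∃ f₀, p f₀
  swap
  · rw [ruleDensity_of_forall_not (fun f hf => hf₀ ⟨f, hf⟩)]
    positivity
  obtain ⟨f₀, hf₀⟩ := hf₀
  have hn0 : (0 : ℝ) < n := by exact_mod_cast hn
  have hAn : (n : ℝ)⁻¹ * A ≤ 1 := by
    rw [inv_mul_le_iff₀ hn0, mul_one]
    exact (Nat.le_ceil A).trans (by exact_mod_cast hnA)
  have hmean := ruleMean_mono (sum_weight_setCycle_le (L := L) w K C hC f₀ p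
    (fun f hf => hpC f f₀ hf hf₀) hp)
  rw [ruleMean_add, ruleMean_sum, ruleMean_mul_left, ruleMean_sum] at hmean
  simp only [ruleMean_mul_left, ruleMean_sum, ruleMean_ite] at hmean
  have hlow : 1 / 2 * ruleDensity p * ∑ k ∈ Finset.range L, 1 / ((k : ℝ) + 1) ≤
      ∑ i : LiftedCycle τ L n with i.Valid K, (1 / ((i.1.val : ℝ) + 1)) *
        ruleDensity fun f' => ∃ f, p f ∧ f' = setCycle f (liftWord w i.1.val) i.2 := by
    rw [Finset.sum_filter, Fintype.sum_sigma, ← Fin.sum_univ_eq_sum_range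
      (fun k => 1 / ((k : ℝ) + 1)), Finset.mul_sum]
    refine Finset.sum_le_sum fun k _ => ?_
    rw [← Finset.sum_filter]
    refine le_trans ?_ (Finset.sum_le_sum fun x _ => mul_le_mul_of_nonneg_left
      (ruleDensity_le_setCycle hn p (liftWord w k.val) x) (by positivity))
    have hk := hhalf k K hK
    have hcard : Nat.card {x : ZMod ((k.val + 1) * τ) → Fin n //
        Function.Injective x ∧ ∀ j, x j ∉ K} = (Finset.univ.filter fun x : ZMod ((k.val + 1) * τ) → Fin n =>
          LiftedCycle.Valid (L := L) K ⟨k, x⟩).card := by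
      rw [Nat.card_eq_fintype_card, Fintype.card_subtype]
      congr!
    rw [hcard] at hk
    refine le_trans ?_ (Finset.sum_const (1 / ((k.val : ℝ) + 1) *
      ((n : ℝ)⁻¹ ^ ((k.val + 1) * τ) * ruleDensity p))).ge
    rw [nsmul_eq_mul]
    have := mul_le_mul_of_nonneg_right hk (mul_nonneg (ruleDensity_nonneg p)
      (by positivity : 0 ≤ 1 / ((k.val : ℝ) + 1)))
    calc _ = 1 / 2 * (ruleDensity p * (1 / ((k.val : ℝ) + 1))) := by ring
      _ ≤ _ := this
      _ = _ := by ring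
  have hup : ∑ i : LiftedCycle τ L n, ∑ i' : LiftedCycle τ L n,
      ruleDensity (BadPair w K C f₀ i i') ≤ (n : ℝ)⁻¹ ^ C.card * ((n : ℝ)⁻¹ * A) := by
    calc _ ≤ ∑ i : LiftedCycle τ L n, ∑ i' : LiftedCycle τ L n,
          (n : ℝ)⁻¹ ^ C.card * ((n : ℝ)⁻¹ * (n : ℝ)⁻¹ ^ (i.states ∪ i'.states).card) :=
          Finset.sum_le_sum fun i _ => Finset.sum_le_sum fun i' _ =>
            ruleDensity_badPair_le hn w K C hC f₀ i i'
      _ = (n : ℝ)⁻¹ ^ C.card * ((n : ℝ)⁻¹ * ∑ i : LiftedCycle τ L n, ∑ i' : LiftedCycle τ L n,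
          (n : ℝ)⁻¹ ^ (i.states ∪ i'.states).card) := by
        simp only [Finset.mul_sum]
      _ ≤ _ := by
        gcongr
        simp only [Fintype.sum_sigma]
        rw [hA]
        refine Finset.sum_le_sum fun k _ => ?_
        rw [Finset.sum_comm]
        refine Finset.sum_le_sum fun k' _ => ?_
        exact sum_sum_inv_pow_card_image_union_le _ _ hn
  have hag : ruleDensity (fun f => ∀ c ∈ C, f c.1 c.2 = f₀ c.1 c.2) ≤ (n : ℝ)⁻¹ ^ C.card :=
    ruleDensity_le_of_agree hn C _ fun f g hf hg c hc => (hf c hc).trans (hg c hc).symm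
  have hpos : 0 < (n : ℝ)⁻¹ ^ C.card := by positivity
  have h1 : 1 / 2 * ruleDensity p * (2 * (τ + 1) / ε) ≤ (τ + 1) * (n : ℝ)⁻¹ ^ C.card := by
    calc _ ≤ 1 / 2 * ruleDensity p * ∑ k ∈ Finset.range L, 1 / ((k : ℝ) + 1) := by
          have := ruleDensity_nonneg p
          gcongr
      _ ≤ _ := hlow
      _ ≤ _ := hmean
      _ ≤ τ * (n : ℝ)⁻¹ ^ C.card + (n : ℝ)⁻¹ ^ C.card * ((n : ℝ)⁻¹ * A) := by
          gcongr
      _ ≤ _ := by nlinarith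
  have h2 : 1 / 2 * ruleDensity p * (2 * (τ + 1) / ε) = (τ + 1) * (ruleDensity p / ε) := by
    field_simp
  rw [h2] at h1
  have h3 := le_of_mul_le_mul_left h1 (by positivity)
  rwa [div_le_iff₀ hε, mul_comm] at h3

/-! ### Dynamics -/

section Dynamics

variable {n : ℕ} (f : CARule n)

lemma caTraj_add (ξ : ℤ → Fin n) (s t : ℕ) : caTraj f ξ (s + t) = caTraj f (caTraj f ξ s) t := by
  induction t with
  | zero => rfl
  | succ t ih => rw [← add_assoc, caTraj, ih, caTraj]

lemma caTraj_shift {ξ : ℤ → Fin n} {d : ℤ} (h : ∀ x, ξ (x + d) = ξ x) (t : ℕ) (x : ℤ) :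
    caTraj f ξ t (x + d) = caTraj f ξ t x := by
  induction t generalizing x with
  | zero => exact h x
  | succ t ih => simp only [caTraj, caStep]; rw [ih, ← ih (x - 1)]; congr 2; ring

lemma caTraj_congr_le {ξ η : ℤ → Fin n} {x : ℤ} (h : ∀ y ≤ x, η y = ξ y) (t : ℕ) :
    ∀ y ≤ x, caTraj f η t y = caTraj f ξ t y := by
  induction t with
  | zero => exact h
  | succ t ih =>
    intro y hy
    simp only [caTraj, caStep]
    rw [ih y hy, ih (y - 1) (by omega)]

lemma chaseSeq_add (A : ℕ → Fin n) (c : Fin n) (k m : ℕ) :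
    chaseSeq f A c (k + m) = chaseSeq f (fun i => A (k + i)) (chaseSeq f A c k) m := by
  induction m with
  | zero => rfl
  | succ m ih => rw [← add_assoc, chaseSeq, ih, chaseSeq]

lemma RightExtends.chaseSeq_eq {A B : ℕ → Fin n} (h : RightExtends f A B) {c : Fin n} {m : ℕ}
    (hm : chaseSeq f A c m = B m) {m' : ℕ} (hmm : m ≤ m') : chaseSeq f A c m' = B m' := by
  induction m', hmm using Nat.le_induction with
  | base => exact hm
  | succ k _ ih => rw [chaseSeq, ih, h]

lemma caTraj_eq_chaseSeq (η : ℤ → Fin n) (x : ℤ) (A : ℕ → Fin n)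
    (h : ∀ t, caTraj f η t x = A t) (t : ℕ) :
    caTraj f η t (x + 1) = chaseSeq f A (η (x + 1)) t := by
  induction t with
  | zero => rfl
  | succ t ih => rw [chaseSeq, ← ih, ← h, caTraj, caStep, add_sub_cancel_right]

variable {τ σ : ℕ}

/-- The space-time array `T` is a weakly robust periodic solution of `f`. -/
structure RobustTile (f : CARule n) (T : ZMod τ × ZMod σ → Fin n) : Prop where
  step : ∀ i j, f (T (i, j)) (T (i, j + 1)) = T (i + 1, j + 1)
  space : ∀ d, (∀ i j, T (i, j + d) = T (i, j)) → d = 0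
  time : ∀ d, (∀ i j, T (i + d, j) = T (i, j)) → d = 0
  decide : ∀ j c, ∃ m : ℕ, chaseSeq f (fun i => T (i, j)) c m = T (m, j + 1)

variable {f}

lemma exists_forall_chaseSeq_phase [NeZero τ] {A B : ZMod τ → Fin n}
    (hs : ∀ i, f (A i) (B i) = B (i + 1))
    (hd : ∀ c, ∃ m : ℕ, chaseSeq f (fun l => A l) c m = B m) (i : ZMod τ) (c : Fin n) :
    ∃ m : ℕ, ∀ m' ≥ m, chaseSeq f (fun l => A (i + l)) c m' = B (i + m') := by
  obtain ⟨m, hm⟩ := hd (chaseSeq f (fun l : ℕ => A (i + l)) c (-i).val)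
  have hi : i + ((-i).val : ZMod τ) = 0 := by simp
  refine ⟨(-i).val + m, fun m' hm' => RightExtends.chaseSeq_eq
    (B := fun l => B (i + l)) f ?_ ?_ hm'⟩
  · intro l
    rw [hs]
    push_cast
    rw [add_assoc]
  · rw [chaseSeq_add]
    push_cast
    simp only [← add_assoc, hi, zero_add]
    exact hm

lemma RobustTile.decide_phase [NeZero τ] {T : ZMod τ × ZMod σ → Fin n} (hT : RobustTile f T)
    (i : ZMod τ) (j : ZMod σ) (c : Fin n) :
    ∃ m : ℕ, ∀ m' ≥ m, chaseSeq f (fun l => T (i + l, j)) c m' = T (i + m', j + 1) :=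
  exists_forall_chaseSeq_phase (A := fun i => T (i, j)) (B := fun i => T (i, j + 1))
    (fun i => hT.step i j) (hT.decide j) i c

lemma exists_robustTile [NeZero τ] [NeZero σ] {ξ : ℤ → Fin n} (hξ : IsPS f ξ τ σ)
    (hr : IsWeaklyRobust f ξ) : ∃ T : ZMod τ × ZMod σ → Fin n, RobustTile f T := by
  obtain ⟨-, -, hσ, hσ', hτ, hτ'⟩ := hξ
  have ht : Function.Periodic (caTraj f ξ) τ := by
    intro t
    rw [add_comm, caTraj_add, hτ]
  have hx : ∀ t, Function.Periodic (caTraj f ξ t) σ := fun t => caTraj_shift f hσ t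
  let T : ZMod τ × ZMod σ → Fin n := fun p => caTraj f ξ p.1.val p.2.val
  have hT : ∀ (t : ℕ) (x : ℤ), T (t, x) = caTraj f ξ t x := by
    intro t x
    simp only [T]
    rw [ZMod.val_natCast, ht.map_mod_nat, ZMod.val_intCast, Int.emod_def, mul_comm]
    have := (hx t).sub_zsmul_eq (x := x) (x / σ)
    simpa using this
  have hn : ∀ i : ZMod τ, ∃ t : ℕ, (t : ZMod τ) = i := fun i => ⟨i.val, by simp⟩
  have hz : ∀ j : ZMod σ, ∃ x : ℤ, (x : ZMod σ) = j := fun j => ⟨j.val, by simp⟩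
  refine ⟨T, ?_, ?_, ?_, ?_⟩
  · intro i j
    obtain ⟨t, rfl⟩ := hn i
    obtain ⟨x, rfl⟩ := hz j
    have h1 := hT t (x + 1)
    have h2 := hT (t + 1) (x + 1)
    push_cast at h1 h2
    rw [hT, h1, h2, caTraj, caStep, add_sub_cancel_right]
  · intro d hd
    by_contra hd0
    have hpos : 0 < d.val := Nat.pos_of_ne_zero fun h => hd0 ((ZMod.val_eq_zero d).1 h)
    have := hσ' d.val hpos fun x => by
      have h1 := hT 0 (x + (d.val : ℤ))
      have h2 := hT 0 x
      push_cast at h1 h2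
      rw [ZMod.natCast_zmod_val, hd, h2] at h1
      exact h1.symm
    exact absurd (ZMod.val_lt d) (by omega)
  · intro d hd
    by_contra hd0
    have hpos : 0 < d.val := Nat.pos_of_ne_zero fun h => hd0 ((ZMod.val_eq_zero d).1 h)
    have := hτ' d.val hpos (by
      funext x
      have h1 := hT (0 + d.val) x
      have h2 := hT 0 x
      push_cast at h1 h2
      rw [ZMod.natCast_zmod_val, hd, h2, zero_add] at h1
      exact h1.symm)
    exact absurd (ZMod.val_lt d) (by omega)
  · intro j c
    obtain ⟨x, rfl⟩ := hz j
    obtain ⟨v, hv, hr⟩ := hr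
    have hle : ∀ y ≤ x, (fun y => if y ≤ x then ξ y else c) y = ξ y := fun y hy => if_pos hy
    have h1 := hr _ ⟨x, hle⟩
    have h2 : ∀ᶠ t : ℕ in atTop, ((x + 1 : ℤ) : ℝ) ≤ v * t :=
      (tendsto_natCast_atTop_atTop.const_mul_atTop hv).eventually_ge_atTop _
    obtain ⟨t, h1, h2⟩ := (h1.and h2).exists
    refine ⟨t, ?_⟩
    have h3 := caTraj_eq_chaseSeq f (fun y => if y ≤ x then ξ y else c) x
      (fun i => T (i, x)) (fun t => by rw [caTraj_congr_le f hle t x le_rfl, hT]) t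
    rw [h1 _ h2] at h3
    simp only [add_le_iff_nonpos_right] at h3
    rw [if_neg (by norm_num)] at h3
    rw [← h3, ← hT]
    push_cast
    rfl

lemma RobustTile.exists_isPS [NeZero τ] [NeZero σ] {T : ZMod τ × ZMod σ → Fin n}
    (hT : RobustTile f T) : ∃ ξ : ℤ → Fin n, IsPS f ξ τ σ ∧ IsWeaklyRobust f ξ := by
  let ξ : ℤ → Fin n := fun x => T (0, x)
  have htraj : ∀ (t : ℕ) (x : ℤ), caTraj f ξ t x = T (t, x) := by
    intro t
    induction t with
    | zero => intro x; simp [caTraj, ξ]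
    | succ t ih =>
      intro x
      rw [caTraj, caStep, ih, ih]
      have := hT.step t ((x - 1 : ℤ) : ZMod σ)
      push_cast at this ⊢
      rwa [sub_add_cancel] at this
  have hn : ∀ i : ZMod τ, ∃ t : ℕ, (t : ZMod τ) = i := fun i => ⟨i.val, by simp⟩
  have hz : ∀ j : ZMod σ, ∃ x : ℤ, (x : ZMod σ) = j := fun j => ⟨j.val, by simp⟩
  refine ⟨ξ, ⟨NeZero.pos τ, NeZero.pos σ, fun x => by simp [ξ], ?_, ?_, ?_⟩, ?_⟩
  · intro d hd h
    have h0 : ((d : ℕ) : ZMod σ) = 0 := by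
      apply hT.space
      intro i j
      obtain ⟨t, rfl⟩ := hn i
      obtain ⟨x, rfl⟩ := hz j
      have := caTraj_shift f h t x
      rw [htraj, htraj] at this
      push_cast at this
      exact this
    exact Nat.le_of_dvd hd ((ZMod.natCast_eq_zero_iff _ _).1 h0)
  · funext x
    rw [htraj]
    simp [ξ]
  · intro d hd h
    have h0 : ((d : ℕ) : ZMod τ) = 0 := by
      apply hT.time
      intro i j
      obtain ⟨t, rfl⟩ := hn i
      obtain ⟨x, rfl⟩ := hz j
      have : caTraj f ξ (d + t) x = caTraj f ξ t x := by rw [caTraj_add, h]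
      rw [htraj, htraj] at this
      push_cast at this
      rwa [add_comm] at this
    exact Nat.le_of_dvd hd ((ZMod.natCast_eq_zero_iff _ _).1 h0)
  · choose m hm using hT.decide_phase
    obtain ⟨M, hM⟩ : ∃ M : ℕ, ∀ p : ZMod τ × ZMod σ × Fin n, m p.1 p.2.1 p.2.2 ≤ M :=
      (Set.finite_range fun p : ZMod τ × ZMod σ × Fin n => m p.1 p.2.1 p.2.2).bddAbove.imp
        fun M hM p => hM ⟨p, rfl⟩
    have hM1 : (0 : ℝ) < (M : ℝ) + 1 := by positivity
    refine ⟨1 / (2 * (M + 1)), by positivity, ?_⟩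
    rintro η ⟨y, hy⟩
    have key : ∀ k t : ℕ, k * (M + 1) ≤ t → ∀ x ≤ y + k, caTraj f η t x = caTraj f ξ t x := by
      intro k
      induction k with
      | zero => intro t _; simpa using caTraj_congr_le f hy t
      | succ k ih =>
        intro t ht x hx
        have hs : k * (M + 1) ≤ t - (M + 1) := by
          rw [Nat.succ_mul] at ht
          omega
        have hts : t = (t - (M + 1)) + (M + 1) := by
          rw [Nat.succ_mul] at ht
          omega
        generalize t - (M + 1) = s at hs hts
        subst hts
        rcases le_or_gt x (y + k) with hxk | hxk
        · exact ih _ (by omega) x hxk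
        · obtain rfl : x = y + k + 1 := by push_cast at hx; omega
          have h1 := caTraj_eq_chaseSeq f (caTraj f η s) (y + k)
            (fun l => T (s + l, ((y + k : ℤ) : ZMod σ)))
            (fun t => by
              rw [← caTraj_add, ih _ (by omega) _ le_rfl, htraj]
              push_cast
              rfl) (M + 1)
          rw [hm _ _ _ _ ((hM (_, _, _)).trans (Nat.le_succ M))] at h1
          rw [caTraj_add, h1, htraj]
          push_cast
          rfl
    have hev : ∀ᶠ t : ℕ in atTop, (2 * (M + 1)) * (1 - (y : ℝ)) ≤ t :=
      tendsto_natCast_atTop_atTop.eventually_ge_atTop _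
    filter_upwards [hev] with t ht x hx
    refine key (t / (M + 1)) t (Nat.div_mul_le_self _ _) x ?_
    have h1 : (t : ℝ) / (M + 1) < (t / (M + 1) : ℕ) + 1 := by
      rw [div_lt_iff₀ hM1]
      have := Nat.lt_mul_div_succ t (Nat.succ_pos M)
      rw [mul_comm] at this
      exact_mod_cast this
    have h2 : (x : ℝ) < y + (t / (M + 1) : ℕ) + 1 - 0 := by
      have h3 : 1 - (y : ℝ) ≤ t / (2 * (M + 1)) := by
        rw [le_div_iff₀ (by positivity)]; linarith
      have h4 : (t : ℝ) / (M + 1) = t / (2 * (M + 1)) + t / (2 * (M + 1)) := by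
        field_simp; ring
      have h5 : 1 / (2 * ((M : ℝ) + 1)) * t = t / (2 * (M + 1)) := by ring
      linarith
    rw [sub_zero] at h2
    generalize t / (M + 1) = q at h2 ⊢
    have h6 : x < y + q + 1 := by exact_mod_cast h2
    omega

end Dynamics

/-! ### Tiles whose columns are rotations of each other -/

section Rotations

variable {n τ σ : ℕ}

/-- The array in which every column is the previous one rotated by `h`. -/
def rotTile (σ : ℕ) (a : ZMod τ → Fin n) (h : ZMod τ) : ZMod τ × ZMod σ → Fin n :=
  fun p => a (p.1 + p.2.val • h)

/-- The word `a` decides its own rotation by `h`. -/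
structure RotRule (f : CARule n) (a : ZMod τ → Fin n) (h : ZMod τ) : Prop where
  step : ∀ i, f (a i) (a (i + h)) = a (i + 1 + h)
  decide : ∀ c, ∃ m : ℕ, chaseSeq f (fun j => a j) c m = a (m + h)

/-- The array is not a rotation array. -/
def NonRot (T : ZMod τ × ZMod σ → Fin n) : Prop :=
  ∀ (a : ZMod τ → Fin n) (h : ZMod τ), Function.Injective a → addOrderOf h = σ →
    T ≠ rotTile σ a h

lemma val_add_one_nsmul [NeZero σ] {h : ZMod τ} (hh : addOrderOf h = σ) (j : ZMod σ) :
    (j + 1).val • h = j.val • h + h := by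
  have h1 : (j + 1).val = (j.val + 1) % σ := by
    rw [← ZMod.val_natCast]
    push_cast
    rw [ZMod.natCast_zmod_val]
  have h2 := mod_addOrderOf_nsmul h (j.val + 1)
  rw [hh] at h2
  rw [h1, ← succ_nsmul, h2]

lemma RotRule.robustTile [NeZero τ] [NeZero σ] {f : CARule n} {a : ZMod τ → Fin n} {h : ZMod τ}
    (hf : RotRule f a h) (ha : Function.Injective a) (hh : addOrderOf h = σ) :
    RobustTile f (rotTile σ a h) where
  step i j := by
    simp only [rotTile, val_add_one_nsmul hh]
    have := hf.step (i + j.val • h)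
    convert this using 2 <;> ring_nf
  space d hd := by
    have := ha (hd 0 0)
    simp only [zero_add, ZMod.val_zero, zero_smul] at this
    rw [← addOrderOf_dvd_iff_nsmul_eq_zero, hh] at this
    rw [← ZMod.val_eq_zero]
    exact Nat.eq_zero_of_dvd_of_lt this (ZMod.val_lt d)
  time d hd := by
    have := ha (hd 0 0)
    simpa using this
  decide j c := by
    obtain ⟨m, hm⟩ := exists_forall_chaseSeq_phase (A := a) (B := fun i => a (i + h))
      (fun i => hf.step i) hf.decide (j.val • h) c
    refine ⟨m, ?_⟩
    simp only [rotTile, val_add_one_nsmul hh]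
    simpa only [add_comm, add_left_comm, add_assoc] using hm m le_rfl

lemma RobustTile.rotRule [NeZero σ] {f : CARule n} {a : ZMod τ → Fin n} {h : ZMod τ}
    (hT : RobustTile f (rotTile σ a h)) (hh : addOrderOf h = σ) : RotRule f a h where
  step i := by
    have := hT.step i 0
    simp only [rotTile, val_add_one_nsmul hh] at this
    simpa using this
  decide c := by
    obtain ⟨m, hm⟩ := hT.decide 0 c
    refine ⟨m, ?_⟩
    simp only [rotTile, val_add_one_nsmul hh] at hm
    simpa using hm

lemma RotRule.rotate [NeZero τ] {f : CARule n} {a : ZMod τ → Fin n} {h : ZMod τ}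
    (hf : RotRule f a h) (r : ZMod τ) : RotRule f (fun i => a (i + r)) h where
  step i := by
    have := hf.step (i + r)
    convert this using 2 <;> ring_nf
  decide c := by
    obtain ⟨m, hm⟩ := exists_forall_chaseSeq_phase (A := a) (B := fun i => a (i + h))
      (fun i => hf.step i) hf.decide r c
    refine ⟨m, ?_⟩
    simpa only [add_comm, add_left_comm, add_assoc] using hm m le_rfl

end Rotations

lemma eventually_cycleDet_small (τ : ℕ) [NeZero τ] {δ : ℝ} (hδ : 0 < δ) :
    ∀ᶠ n : ℕ in atTop, ∀ d ≥ 2, cycleDet τ (n : ℝ)⁻¹ ^ d ≤ δ * (n : ℝ)⁻¹ := by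
  obtain ⟨c, hc⟩ := exists_tendsto_mul_cycleDet τ
  have h0 : Tendsto (fun n : ℕ => cycleDet τ (n : ℝ)⁻¹) atTop (nhds 0) := by
    have := hc.mul (tendsto_inv_atTop_nhds_zero_nat (𝕜 := ℝ))
    rw [mul_zero] at this
    refine this.congr' ?_
    filter_upwards [eventually_gt_atTop 0] with n hn
    have : (n : ℝ) ≠ 0 := by exact_mod_cast hn.ne'
    field_simp
  have h1 : Tendsto (fun n : ℕ => (n : ℝ) * cycleDet τ (n : ℝ)⁻¹ * cycleDet τ (n : ℝ)⁻¹) atTop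
      (nhds 0) := by
    simpa using hc.mul h0
  have h0' := h0.abs
  rw [abs_zero] at h0'
  filter_upwards [h0'.eventually (gt_mem_nhds one_pos), h1.eventually (gt_mem_nhds hδ),
    eventually_gt_atTop 0] with n ha hb hn d hd
  have hn0 : (0 : ℝ) < n := by exact_mod_cast hn
  calc cycleDet τ (n : ℝ)⁻¹ ^ d ≤ |cycleDet τ (n : ℝ)⁻¹| ^ d := by
        rw [← abs_pow]; exact le_abs_self _
    _ ≤ |cycleDet τ (n : ℝ)⁻¹| ^ 2 := pow_le_pow_of_le_one (abs_nonneg _) ha.le hd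
    _ ≤ δ * (n : ℝ)⁻¹ := by
        rw [sq_abs, ← div_eq_mul_inv, le_div_iff₀ hn0]
        linarith

section SimpleTiles

variable {n τ σ : ℕ}

/-- If the entries are determined both by their left and by their right states, then equal
states have equal surroundings. -/
lemma RobustTile.eq_add [NeZero τ] [NeZero σ] {f : CARule n} {T : ZMod τ × ZMod σ → Fin n}
    (hT : RobustTile f T) (hs : ∀ p q, T p = T q → T (p + (0, 1)) = T (q + (0, 1)))
    {p q : ZMod τ × ZMod σ} (hpq : T p = T q) (v : ZMod τ × ZMod σ) : T (p + v) = T (q + v) := by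
  have h1 : ∀ (m : ℕ) (p q), T p = T q → T (p + (0, (m : ZMod σ))) = T (q + (0, (m : ZMod σ))) := by
    intro m
    induction m with
    | zero => intro p q h; simpa [Prod.mk_zero_zero] using h
    | succ m ih =>
      intro p q h
      have := hs _ _ (ih p q h)
      simpa [add_assoc] using this
  have h1' : ∀ (j : ZMod σ) (p q), T p = T q → T (p + (0, j)) = T (q + (0, j)) := by
    intro j p q h
    simpa using h1 j.val p q h
  have h2 : ∀ p q, T p = T q → T (p + (1, 0)) = T (q + (1, 0)) := by
    intro p q h
    have h3 : T (p + (1, 1)) = T (q + (1, 1)) := by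
      obtain ⟨i, j⟩ := p
      obtain ⟨k, m⟩ := q
      have := hs _ _ h
      simp only [Prod.mk_add_mk, add_zero] at this ⊢
      rw [← hT.step, ← hT.step, h, this]
    have := h1' (-1) _ _ h3
    simpa [add_assoc] using this
  have h3 : ∀ (m : ℕ) (p q), T p = T q → T (p + ((m : ZMod τ), 0)) = T (q + ((m : ZMod τ), 0)) := by
    intro m
    induction m with
    | zero => intro p q h; simpa [Prod.mk_zero_zero] using h
    | succ m ih =>
      intro p q h
      have := h2 _ _ (ih p q h)
      simpa [add_assoc] using this
  have := h1' v.2 _ _ (h3 v.1.val p q hpq)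
  simpa [add_assoc] using this

/-- The periods of an array all of whose repetitions are translations. -/
lemma RobustTile.nonRot_or [NeZero τ] [NeZero σ] {f : CARule n} {T : ZMod τ × ZMod σ → Fin n}
    (hT : RobustTile f T) (hs : ∀ p q, T p = T q → T (p + (0, 1)) = T (q + (0, 1)))
    (hnr : NonRot T) :
    ∃ d : ℕ, 2 ≤ d ∧ (Function.Injective fun p : ZMod τ × Fin d => T (p.1, (p.2.val : ZMod σ))) ∧
      (Finset.univ.image T).card ≤ τ * d := by
  have heq : ∀ {p q : ZMod τ × ZMod σ}, T p = T q → ∀ v, T (p + v) = T (q + v) :=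
    fun h v => hT.eq_add hs h v
  have hper : ∀ {p q : ZMod τ × ZMod σ}, T p = T q → ∀ v, T (v + (p - q)) = T v := by
    intro p q h v
    have := heq h (v - q)
    rwa [add_sub_cancel, show p + (v - q) = v + (p - q) by abel] at this
  have htime : ∀ {i k : ZMod τ} {j : ZMod σ}, T (i, j) = T (k, j) → i = k := by
    intro i k j h
    have := hT.time (i - k) fun x y => by simpa using hper h (x, y)
    exact sub_eq_zero.1 this
  have hspace : ∀ {j m : ZMod σ}, T (0, j) = T (0, m) → j = m := by
    intro j m h
    have := hT.space (j - m) fun x y => by simpa using hper h (x, y)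
    exact sub_eq_zero.1 this
  have hex : ∃ d : ℕ, 0 < d ∧ ∃ u : ZMod τ, T (u, (d : ZMod σ)) = T 0 :=
    ⟨σ, NeZero.pos σ, 0, by simp [Prod.mk_zero_zero]⟩
  classical
  obtain ⟨hd0, u, hu⟩ := Nat.find_spec hex
  have hmin : ∀ m, 0 < m → m < Nat.find hex → ∀ v : ZMod τ, T (v, (m : ZMod σ)) ≠ T 0 :=
    fun m hm hlt v hv => Nat.find_min hex hlt ⟨hm, v, hv⟩
  generalize Nat.find hex = d at hd0 hu hmin
  have hmul : ∀ (m : ℕ) v, T (v + m • (u, (d : ZMod σ))) = T v := by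
    intro m
    induction m with
    | zero => intro v; simp
    | succ m ih =>
      intro v
      have := hper hu (v + m • (u, (d : ZMod σ)))
      rw [sub_zero] at this
      rw [succ_nsmul, ← add_assoc, this, ih]
  have hd2 : 2 ≤ d := by
    by_contra hlt
    obtain rfl : d = 1 := by omega
    refine hnr (fun i => T (i, 0)) (-u) (fun i k h => htime h) ?_ ?_
    · rw [addOrderOf_neg]
      apply Nat.dvd_antisymm
      · rw [addOrderOf_dvd_iff_nsmul_eq_zero]
        have := hmul σ 0
        simp only [Prod.smul_mk, Nat.cast_one, nsmul_eq_mul, CharP.cast_eq_zero, zero_mul,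
          zero_add] at this
        have := htime (j := 0) (this.trans rfl)
        simpa using this
      · have := hmul (addOrderOf u) 0
        rw [Prod.smul_mk, addOrderOf_nsmul_eq_zero] at this
        have := hspace (j := (addOrderOf u) • ((1 : ℕ) : ZMod σ)) (m := 0)
          (by simpa [Prod.mk_zero_zero] using this)
        simpa [ZMod.natCast_eq_zero_iff] using this
    · funext ⟨i, j⟩
      have := hmul j.val (i + j.val • (-u), 0)
      simp only [rotTile]
      rw [← this]
      simp
  refine ⟨d, hd2, ?_, ?_⟩
  · have hlt : ∀ (i i' : ZMod τ) (k k' : Fin d), T (i, (k.val : ZMod σ)) = T (i', (k'.val : ZMod σ)) →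
        k.val ≤ k'.val := by
      intro i i' k k' h
      by_contra! hkk
      have := hper h 0
      have h1 : (k.val : ZMod σ) - (k'.val : ZMod σ) = ((k.val - k'.val : ℕ) : ZMod σ) := by
        rw [Nat.cast_sub hkk.le]
      rw [zero_add, Prod.mk_sub_mk, h1] at this
      exact hmin _ (by omega) (by omega) _ this
    rintro ⟨i, k⟩ ⟨i', k'⟩ h
    have hk : k = k' := Fin.ext (le_antisymm (hlt _ _ _ _ h) (hlt _ _ _ _ h.symm))
    subst hk
    exact congrArg (·, k) (htime h)
  · have hsub : Finset.univ.image T ⊆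
        Finset.univ.image fun p : ZMod τ × Fin d => T (p.1, (p.2.val : ZMod σ)) := by
      intro y hy
      obtain ⟨⟨i, j⟩, -, rfl⟩ := Finset.mem_image.1 hy
      refine Finset.mem_image.2 ⟨(i - (j.val / d) • u, ⟨j.val % d, Nat.mod_lt _ hd0⟩),
        Finset.mem_univ _, ?_⟩
      rw [← hmul (j.val / d)]
      congr 1
      simp only [Prod.smul_mk, Prod.mk_add_mk, sub_add_cancel, Prod.mk.injEq, true_and]
      rw [nsmul_eq_mul, ← Nat.cast_mul, ← Nat.cast_add, Nat.mod_add_div']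
      simp
    refine (Finset.card_le_card hsub).trans (Finset.card_image_le.trans ?_)
    simp [ZMod.card]

end SimpleTiles

section Bounds

lemma Finset.injOn_of_image_eq_of_card_le {α β : Type*} [DecidableEq β] {g : α → β} {s : Finset α}
    {t : Finset β} (h : s.image g = t) (hc : s.card ≤ t.card) : Set.InjOn g s := by
  apply Finset.injOn_of_card_image_eq
  exact le_antisymm Finset.card_image_le (h ▸ hc)

lemma eventually_ruleDensity_robustTile_small (τ σ : ℕ) [NeZero τ] [NeZero σ] {δ : ℝ}
    (hδ : 0 < δ) :
    ∀ᶠ n : ℕ in atTop, ∀ T : ZMod τ × ZMod σ → Fin n, NonRot T →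
      ruleDensity (fun f => RobustTile f T) ≤
        δ * (n : ℝ)⁻¹ * (n : ℝ)⁻¹ ^ (Finset.univ.image T).card := by
  filter_upwards [ruleDensity_eventually_small τ (τ * σ) hδ, eventually_cycleDet_small τ hδ,
    eventually_gt_atTop 0] with n hG hdet hn T hnr
  by_cases hex : ∃ f, RobustTile f T
  swap
  · rw [ruleDensity_of_forall_not fun f hf => hex ⟨f, hf⟩]
    positivity
  obtain ⟨f₀, hf₀⟩ := hex
  have hn0 : (0 : ℝ) < n := by exact_mod_cast hn
  have hn1 : (n : ℝ)⁻¹ ≤ 1 := inv_le_one_of_one_le₀ (by exact_mod_cast hn)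
  set C : Finset (Fin n × Fin n) := Finset.univ.image fun p => (T p, T (p + (0, 1))) with hC
  set K : Finset (Fin n) := Finset.univ.image T with hK
  have hfst : C.image Prod.fst = K := by
    rw [hC, Finset.image_image]; rfl
  have hsnd : C.image Prod.snd = K := by
    rw [hC, Finset.image_image, hK]
    ext y
    simp only [Finset.mem_image, Finset.mem_univ, true_and, Function.comp_apply]
    exact (Equiv.addRight ((0, 1) : ZMod τ × ZMod σ)).exists_congr_left.trans (by simp)
  have hCp : ∀ p, (T p, T (p + (0, 1))) ∈ C := fun p => Finset.mem_image_of_mem _ (Finset.mem_univ p)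
  rcases lt_or_ge K.card C.card with hlt | hle
  · refine (hG (fun i => T (i, 0)) K C _ ?_ ?_ ?_ ?_).trans ?_
    · refine Finset.card_image_le.trans ?_
      simp [ZMod.card]
    · intro c hc
      rw [← hsnd]
      exact Finset.mem_image_of_mem _ hc
    · intro f g hf hg c hc
      obtain ⟨⟨i, j⟩, -, rfl⟩ := Finset.mem_image.1 hc
      simp only [Prod.mk_add_mk, add_zero]
      rw [hf.step, hg.step]
    · intro f hf c
      obtain ⟨m, hm⟩ := hf.decide 0 c
      exact ⟨m, by rw [hm]; exact Finset.mem_image_of_mem _ (Finset.mem_univ _)⟩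
    · rw [mul_assoc, ← pow_succ']
      exact mul_le_mul_of_nonneg_left (pow_le_pow_of_le_one (by positivity) hn1 hlt) hδ.le
  · have hinj := Finset.injOn_of_image_eq_of_card_le hfst hle
    have hs : ∀ p q, T p = T q → T (p + (0, 1)) = T (q + (0, 1)) := fun p q h =>
      congrArg Prod.snd (hinj (hCp p) (hCp q) h)
    obtain ⟨d, hd, hTinj, hcard⟩ := hf₀.nonRot_or hs hnr
    have hdec := ruleDensity_decides hn (fun p : ZMod τ × Fin d => T (p.1, (p.2.val : ZMod σ)))
      hTinj (fun p => T (p.1, (p.2.val : ZMod σ) + 1))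
    calc ruleDensity (fun f => RobustTile f T) ≤ _ :=
          ruleDensity_mono fun f hf => ⟨fun l => hf.step l.1 l.2.val, fun k c => hf.decide k.val c⟩
      _ = _ := hdec
      _ ≤ (n : ℝ)⁻¹ ^ (τ * d) * (δ * (n : ℝ)⁻¹) := by
        rw [Fintype.card_fin]
        exact mul_le_mul_of_nonneg_left (hdet d hd) (by positivity)
      _ ≤ (n : ℝ)⁻¹ ^ K.card * (δ * (n : ℝ)⁻¹) :=
        mul_le_mul_of_nonneg_right (pow_le_pow_of_le_one (by positivity) hn1 hcard) (by positivity)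
      _ = _ := mul_comm _ _

lemma RotRule.exists_rotation {n τ : ℕ} [NeZero τ] {f : CARule n}
    {a a' : ZMod τ → Fin n} {h h' : ZMod τ} (ha : Function.Injective a) (hf : RotRule f a h)
    (hf' : RotRule f a' h') (hfst : ∀ i k, a i = a' k → a (i + h) = a' (k + h'))
    (hsnd : ∀ i k, a (i + h) = a' (k + h') → a i = a' k) {i k : ZMod τ} (hik : a i = a' k) :
    (∃ r, a' = fun i => a (i + r)) ∧ h' = h := by
  have hstep : ∀ i k, a i = a' k → a (i + 1) = a' (k + 1) := by
    intro i k hik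
    apply hsnd
    rw [← hf.step, ← hf'.step, hfst i k hik, hik]
  have hm : ∀ m : ℕ, a (i + m) = a' (k + m) := by
    intro m
    induction m with
    | zero => simpa using hik
    | succ m ih =>
      push_cast
      rw [← add_assoc, ← add_assoc]
      exact hstep _ _ ih
  have hv : ∀ v, a (i + v) = a' (k + v) := fun v => by simpa using hm v.val
  refine ⟨⟨i - k, ?_⟩, ?_⟩
  · funext v
    rw [show v + (i - k) = i + (v - k) by ring, hv]
    congr 1
    ring
  · have := hfst i k hik
    rw [← hv] at this
    exact (add_left_cancel (ha this)).symm

lemma eventually_ruleDensity_rotRule_pair_small (τ : ℕ) [NeZero τ] {δ : ℝ} (hδ : 0 < δ) :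
    ∀ᶠ n : ℕ in atTop, ∀ (a a' : ZMod τ → Fin n) (h h' : ZMod τ), Function.Injective a →
      Function.Injective a' → ¬ ((∃ r, a' = fun i => a (i + r)) ∧ h' = h) →
      ruleDensity (fun f => RotRule f a h ∧ RotRule f a' h') ≤
        δ * (n : ℝ)⁻¹ * (n : ℝ)⁻¹ ^ (Finset.univ.image a ∪ Finset.univ.image a').card := by
  filter_upwards [ruleDensity_eventually_small τ (τ + τ) hδ, eventually_cycleDet_small τ hδ,
    eventually_gt_atTop 0] with n hG hdet hn a a' h h' ha ha' hne
  by_cases hex : ∃ f, RotRule f a h ∧ RotRule f a' h'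
  swap
  · rw [ruleDensity_of_forall_not fun f hf => hex ⟨f, hf⟩]
    positivity
  obtain ⟨f₀, hf₀, hf₀'⟩ := hex
  have hn0 : (0 : ℝ) < n := by exact_mod_cast hn
  have hn1 : (n : ℝ)⁻¹ ≤ 1 := inv_le_one_of_one_le₀ (by exact_mod_cast hn)
  set C : Finset (Fin n × Fin n) := (Finset.univ.image fun i => (a i, a (i + h))) ∪
    Finset.univ.image fun i => (a' i, a' (i + h')) with hC
  set K : Finset (Fin n) := Finset.univ.image a ∪ Finset.univ.image a' with hK
  have hKcard : K.card ≤ τ + τ := by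
    refine (Finset.card_union_le _ _).trans (add_le_add ?_ ?_) <;>
    · refine Finset.card_image_le.trans ?_
      simp [ZMod.card]
  have hshift : ∀ (b : ZMod τ → Fin n) (g : ZMod τ),
      (Finset.univ.image fun i => b (i + g)) = Finset.univ.image b := by
    intro b g
    ext y
    simp only [Finset.mem_image, Finset.mem_univ, true_and]
    exact (Equiv.addRight g).exists_congr_left.trans (by simp)
  have hfst : C.image Prod.fst = K := by
    rw [hC, Finset.image_union, Finset.image_image, Finset.image_image]; rfl
  have hsnd : C.image Prod.snd = K := by
    rw [hC, Finset.image_union, Finset.image_image, Finset.image_image, hK, ← hshift a h,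
      ← hshift a' h']
    rfl
  by_cases hmeet : ∃ i k, a i = a' k
  · obtain ⟨i, k, hik⟩ := hmeet
    have hlt : K.card < C.card := by
      by_contra! hle
      have h1 := Finset.injOn_of_image_eq_of_card_le hfst hle
      have h2 := Finset.injOn_of_image_eq_of_card_le hsnd hle
      have hCa : ∀ i, (a i, a (i + h)) ∈ C := fun i =>
        Finset.mem_union_left _ (Finset.mem_image_of_mem _ (Finset.mem_univ i))
      have hCa' : ∀ i, (a' i, a' (i + h')) ∈ C := fun i =>
        Finset.mem_union_right _ (Finset.mem_image_of_mem (fun i => (a' i, a' (i + h')))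
          (Finset.mem_univ i))
      exact hne (hf₀.exists_rotation ha hf₀'
        (fun i k hh => congrArg Prod.snd (h1 (hCa i) (hCa' k) hh))
        (fun i k hh => congrArg Prod.fst (h2 (hCa i) (hCa' k) hh)) hik)
    refine (hG a K C _ hKcard ?_ ?_ ?_).trans ?_
    · intro c hc
      rw [← hsnd]
      exact Finset.mem_image_of_mem _ hc
    · rintro f g ⟨hf, hf'⟩ ⟨hg, hg'⟩ c hc
      simp only [hC, Finset.mem_union, Finset.mem_image, Finset.mem_univ, true_and] at hc
      rcases hc with ⟨i, rfl⟩ | ⟨i, rfl⟩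
      · exact (hf.step i).trans (hg.step i).symm
      · exact (hf'.step i).trans (hg'.step i).symm
    · intro f hf c
      obtain ⟨m, hm⟩ := hf.1.decide c
      refine ⟨m, ?_⟩
      rw [hm]
      exact Finset.mem_union_left _ (Finset.mem_image_of_mem _ (Finset.mem_univ _))
    · rw [mul_assoc, ← pow_succ']
      exact mul_le_mul_of_nonneg_left (pow_le_pow_of_le_one (by positivity) hn1 hlt) hδ.le
  · push Not at hmeet
    have hinj : Function.Injective fun p : ZMod τ × Bool => if p.2 then a p.1 else a' p.1 := by
      rintro ⟨i, b⟩ ⟨k, b'⟩ hh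
      cases b <;> cases b' <;> simp only [Bool.false_eq_true, if_true, if_false] at hh
      · rw [ha' hh]
      · exact absurd hh.symm (hmeet _ _)
      · exact absurd hh (hmeet _ _)
      · rw [ha hh]
    have hdec := ruleDensity_decides hn _ hinj
      (fun p => if p.2 then a (p.1 + h) else a' (p.1 + h'))
    calc ruleDensity (fun f => RotRule f a h ∧ RotRule f a' h') ≤ _ := ruleDensity_mono ?_
      _ = _ := hdec
      _ ≤ (n : ℝ)⁻¹ ^ (τ + τ) * (δ * (n : ℝ)⁻¹) := by
        rw [Fintype.card_bool, mul_two]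
        exact mul_le_mul_of_nonneg_left (hdet 2 le_rfl) (by positivity)
      _ ≤ (n : ℝ)⁻¹ ^ K.card * (δ * (n : ℝ)⁻¹) :=
        mul_le_mul_of_nonneg_right (pow_le_pow_of_le_one (by positivity) hn1 hKcard) (by positivity)
      _ = _ := mul_comm _ _
    rintro f ⟨hf, hf'⟩
    refine ⟨?_, ?_⟩
    · rintro ⟨i, _ | _⟩
      · exact hf'.step i
      · exact hf.step i
    · rintro (_ | _) c
      · exact hf'.decide c
      · exact hf.decide c

lemma ruleDensity_rotRule {n τ : ℕ} [NeZero τ] (hn : 0 < n) {a : ZMod τ → Fin n}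
    (ha : Function.Injective a) (h : ZMod τ) :
    ruleDensity (fun f => RotRule f a h) = (n : ℝ)⁻¹ ^ τ * cycleDet τ (n : ℝ)⁻¹ := by
  have hinj : Function.Injective fun p : ZMod τ × Unit => a p.1 := fun p q hpq =>
    Prod.ext (ha hpq) rfl
  have hdec := ruleDensity_decides hn _ hinj (fun p => a (p.1 + h))
  rw [Fintype.card_unit, mul_one, pow_one] at hdec
  rw [← hdec]
  refine le_antisymm (ruleDensity_mono fun f hf => ⟨fun l => hf.step l.1, fun _ c => hf.decide c⟩)
    (ruleDensity_mono fun f hf => ⟨fun i => hf.1 (i, ()), fun c => hf.2 () c⟩)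

end Bounds

section Counting

variable {τ n : ℕ} [NeZero τ]

open Classical in
/-- The pairs of an injective word of length `τ` and a rotation of order `σ`. -/
noncomputable def rotPairs (τ σ n : ℕ) [NeZero τ] : Finset ((ZMod τ → Fin n) × ZMod τ) :=
  (Finset.univ.filter Function.Injective) ×ˢ (Finset.univ.filter fun h => addOrderOf h = σ)

lemma mem_rotPairs {σ : ℕ} {p : (ZMod τ → Fin n) × ZMod τ} :
    p ∈ rotPairs τ σ n ↔ Function.Injective p.1 ∧ addOrderOf p.2 = σ := by
  simp [rotPairs]

lemma card_rotPairs (τ σ n : ℕ) [NeZero τ] : (rotPairs τ σ n).card =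
    n.descFactorial τ * (Finset.univ.filter fun h : ZMod τ => addOrderOf h = σ).card := by
  classical
  rw [rotPairs, Finset.card_product]
  congr 1
  · rw [← Fintype.card_subtype, Fintype.card_congr (Equiv.subtypeInjectiveEquivEmbedding _ _),
      Fintype.card_embedding_eq, ZMod.card, Fintype.card_fin]

/-- The second pair is a rotation of the first one. -/
def IsRotation (p p' : (ZMod τ → Fin n) × ZMod τ) : Prop :=
  (∃ r, p'.1 = fun i => p.1 (i + r)) ∧ p'.2 = p.2

open Classical in
lemma indicator_robustTile_le {σ : ℕ} [NeZero σ] (f : CARule n) :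
    (if ∃ T : ZMod τ × ZMod σ → Fin n, RobustTile f T then (1 : ℝ) else 0) ≤
      (τ : ℝ)⁻¹ * (∑ p ∈ rotPairs τ σ n, if RotRule f p.1 p.2 then (1 : ℝ) else 0) +
        ∑ T : ZMod τ × ZMod σ → Fin n with NonRot T, if RobustTile f T then (1 : ℝ) else 0 := by
  have h0 : (0 : ℝ) ≤ ∑ p ∈ rotPairs τ σ n, if RotRule f p.1 p.2 then (1 : ℝ) else 0 :=
    Finset.sum_nonneg fun p _ => by split_ifs <;> norm_num
  have h1 : ∀ T : ZMod τ × ZMod σ → Fin n, (0 : ℝ) ≤ if RobustTile f T then (1 : ℝ) else 0 :=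
    fun T => by split_ifs <;> norm_num
  have hτ : (0 : ℝ) < τ := by exact_mod_cast NeZero.pos τ
  split_ifs with hex
  swap
  · exact add_nonneg (mul_nonneg (by positivity) h0) (Finset.sum_nonneg fun T _ => h1 T)
  obtain ⟨T, hT⟩ := hex
  by_cases hnr : NonRot T
  · refine le_add_of_nonneg_of_le (mul_nonneg (by positivity) h0) ?_
    have := Finset.single_le_sum (f := fun T : ZMod τ × ZMod σ → Fin n =>
      if RobustTile f T then (1 : ℝ) else 0) (fun T _ => h1 T)
      (Finset.mem_filter.2 ⟨Finset.mem_univ T, hnr⟩)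
    simpa only [if_pos hT] using this
  · refine le_add_of_le_of_nonneg ?_ (Finset.sum_nonneg fun T _ => h1 T)
    simp only [NonRot, not_forall, not_not] at hnr
    obtain ⟨a, h, ha, hh, rfl⟩ := hnr
    have hrot := hT.rotRule hh
    rw [le_inv_mul_iff₀ hτ, mul_one, Finset.sum_boole, Nat.cast_le]
    have hinj : Function.Injective fun r : ZMod τ => ((fun i => a (i + r)), h) := by
      intro r r' hr
      have := ha (congrFun (congrArg Prod.fst hr) 0)
      simpa using this
    calc τ = (Finset.univ : Finset (ZMod τ)).card := by rw [Finset.card_univ, ZMod.card]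
      _ = (Finset.univ.image fun r : ZMod τ => ((fun i => a (i + r)), h)).card :=
        (Finset.card_image_of_injective _ hinj).symm
      _ ≤ _ := by
        apply Finset.card_le_card
        intro p hp
        obtain ⟨r, -, rfl⟩ := Finset.mem_image.1 hp
        refine Finset.mem_filter.2 ⟨mem_rotPairs.2 ⟨fun i k hik => ?_, hh⟩, hrot.rotate r⟩
        exact add_right_cancel (ha hik)

open Classical in
lemma count_rotRule_le {σ : ℕ} [NeZero σ] (f : CARule n) :
    (τ : ℝ)⁻¹ * (∑ p ∈ rotPairs τ σ n, if RotRule f p.1 p.2 then (1 : ℝ) else 0) ≤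
      (if ∃ T : ZMod τ × ZMod σ → Fin n, RobustTile f T then (1 : ℝ) else 0) +
        ∑ p ∈ rotPairs τ σ n, ∑ p' ∈ rotPairs τ σ n with ¬ IsRotation p p',
          if RotRule f p.1 p.2 ∧ RotRule f p'.1 p'.2 then (1 : ℝ) else 0 := by
  have h1 : ∀ p p' : (ZMod τ → Fin n) × ZMod τ,
      (0 : ℝ) ≤ if RotRule f p.1 p.2 ∧ RotRule f p'.1 p'.2 then (1 : ℝ) else 0 :=
    fun p p' => by split_ifs <;> norm_num
  have hτ : (0 : ℝ) < τ := by exact_mod_cast NeZero.pos τ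
  have hτ1 : (1 : ℝ) ≤ τ := by exact_mod_cast NeZero.pos τ
  rw [Finset.sum_boole]
  set S := (rotPairs τ σ n).filter fun p => RotRule f p.1 p.2
  rcases S.eq_empty_or_nonempty with hE | ⟨p₀, hp₀⟩
  · rw [hE, Finset.card_empty, Nat.cast_zero, mul_zero]
    exact add_nonneg (by split_ifs <;> norm_num)
      (Finset.sum_nonneg fun p _ => Finset.sum_nonneg fun p' _ => h1 p p')
  obtain ⟨hp₀V, hf₀⟩ := Finset.mem_filter.1 hp₀
  obtain ⟨hinj, hord⟩ := mem_rotPairs.1 hp₀V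
  rw [if_pos ⟨_, hf₀.robustTile hinj hord⟩,
    ← Finset.card_filter_add_card_filter_not (s := S) (fun p => IsRotation p₀ p), Nat.cast_add,
    mul_add]
  apply add_le_add
  · rw [inv_mul_le_iff₀ hτ, mul_one, Nat.cast_le]
    have hsub : S.filter (fun p => IsRotation p₀ p) ⊆
        Finset.univ.image fun r : ZMod τ => ((fun i => p₀.1 (i + r)), p₀.2) := by
      intro p hp
      obtain ⟨-, ⟨r, hr⟩, hh⟩ := Finset.mem_filter.1 hp
      exact Finset.mem_image.2 ⟨r, Finset.mem_univ _, Prod.ext hr.symm hh.symm⟩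
    refine (Finset.card_le_card hsub).trans (Finset.card_image_le.trans ?_)
    rw [Finset.card_univ, ZMod.card]
  · refine le_trans ?_ (Finset.single_le_sum (f := fun p =>
      ∑ p' ∈ rotPairs τ σ n with ¬ IsRotation p p',
        if RotRule f p.1 p.2 ∧ RotRule f p'.1 p'.2 then (1 : ℝ) else 0)
      (fun p _ => Finset.sum_nonneg fun p' _ => h1 p p') hp₀V)
    rw [Finset.sum_boole]
    refine le_trans (mul_le_of_le_one_left (by positivity) (inv_le_one_of_one_le₀ hτ1)) ?_
    rw [Nat.cast_le]
    apply Finset.card_le_card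
    intro p hp
    obtain ⟨hpS, hpr⟩ := Finset.mem_filter.1 hp
    obtain ⟨hpV, hpf⟩ := Finset.mem_filter.1 hpS
    exact Finset.mem_filter.2 ⟨Finset.mem_filter.2 ⟨hpV, hpr⟩, hf₀, hpf⟩

/-- The expected number of rotation arrays which are robust, counted up to rotation. -/
noncomputable def rotMean (τ σ n : ℕ) [NeZero τ] : ℝ :=
  (τ : ℝ)⁻¹ * ∑ p ∈ rotPairs τ σ n, ruleDensity fun f => RotRule f p.1 p.2

lemma exists_tendsto_mul_rotMean (τ σ : ℕ) [NeZero τ] :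
    ∃ c, Tendsto (fun n : ℕ => n * rotMean τ σ n) atTop (nhds c) := by
  obtain ⟨c, hc⟩ := exists_tendsto_mul_cycleDet τ
  have hdf : Tendsto (fun n : ℕ => (n : ℝ)⁻¹ ^ τ * n.descFactorial τ) atTop (nhds 1) := by
    have := (isEquivalent_descFactorial τ)
    rw [Asymptotics.isEquivalent_iff_tendsto_one] at this
    · refine this.congr fun n => ?_
      simp only [Pi.div_apply, inv_pow]
      rw [div_eq_inv_mul]
    · filter_upwards [eventually_gt_atTop 0] with n hn
      have : (0 : ℝ) < n := by exact_mod_cast hn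
      positivity
  refine ⟨_, ((hdf.mul hc).const_mul ((τ : ℝ)⁻¹ *
    (Finset.univ.filter fun h : ZMod τ => addOrderOf h = σ).card)).congr' ?_⟩
  filter_upwards [eventually_gt_atTop 0] with n hn
  rw [rotMean, Finset.sum_congr rfl fun p hp => ruleDensity_rotRule hn (mem_rotPairs.1 hp).1 p.2,
    Finset.sum_const, card_rotPairs, nsmul_eq_mul]
  push_cast
  ring

lemma eventually_abs_ruleDensity_sub_rotMean_le (τ σ : ℕ) [NeZero τ] [NeZero σ] {ε : ℝ}
    (hε : 0 < ε) :
    ∀ᶠ n : ℕ in atTop, |n * ruleDensity (fun f : CARule n =>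
      ∃ T : ZMod τ × ZMod σ → Fin n, RobustTile f T) - n * rotMean τ σ n| ≤ ε := by
  classical
  set B₁ : ℝ := (Fintype.card (ZMod τ × ZMod σ → ZMod τ × ZMod σ) : ℝ) with hB₁
  set B₂ : ℝ := τ * (τ * (Fintype.card (ZMod τ ⊕ ZMod τ → ZMod τ ⊕ ZMod τ) : ℝ)) with hB₂
  have hB : 0 < B₁ + B₂ + 1 := by positivity
  set δ := ε / (B₁ + B₂ + 1) with hδdef
  have hδ : 0 < δ := by positivity
  filter_upwards [eventually_ruleDensity_robustTile_small τ σ hδ,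
    eventually_ruleDensity_rotRule_pair_small τ hδ, eventually_gt_atTop 0] with n h1 h2 hn
  have hn0 : (0 : ℝ) < n := by exact_mod_cast hn
  have hup := ruleMean_mono (indicator_robustTile_le (τ := τ) (n := n) (σ := σ))
  have hlow := ruleMean_mono (count_rotRule_le (τ := τ) (n := n) (σ := σ))
  simp only [ruleMean_add, ruleMean_mul_left, ruleMean_sum, ruleMean_ite] at hup hlow
  rw [← rotMean] at hup hlow
  have hs1 : ∑ T : ZMod τ × ZMod σ → Fin n with NonRot T, ruleDensity (fun f => RobustTile f T) ≤
      δ * (n : ℝ)⁻¹ * B₁ := by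
    calc _ ≤ ∑ T : ZMod τ × ZMod σ → Fin n with NonRot T,
          δ * (n : ℝ)⁻¹ * (n : ℝ)⁻¹ ^ (Finset.univ.image T).card :=
          Finset.sum_le_sum fun T hT => h1 T (Finset.mem_filter.1 hT).2
      _ ≤ ∑ T : ZMod τ × ZMod σ → Fin n,
          δ * (n : ℝ)⁻¹ * (n : ℝ)⁻¹ ^ (Finset.univ.image T).card :=
          Finset.sum_le_sum_of_subset_of_nonneg (Finset.filter_subset _ _)
            fun T _ _ => by positivity
      _ ≤ _ := by
        rw [← Finset.mul_sum]
        gcongr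
        exact sum_inv_pow_card_image_le _ hn
  have hs2 : ∑ p ∈ rotPairs τ σ n, ∑ p' ∈ rotPairs τ σ n with ¬ IsRotation p p',
      ruleDensity (fun f => RotRule f p.1 p.2 ∧ RotRule f p'.1 p'.2) ≤ δ * (n : ℝ)⁻¹ * B₂ := by
    calc _ ≤ ∑ p ∈ rotPairs τ σ n, ∑ p' ∈ rotPairs τ σ n with ¬ IsRotation p p',
          δ * (n : ℝ)⁻¹ * (n : ℝ)⁻¹ ^ (Finset.univ.image p.1 ∪ Finset.univ.image p'.1).card :=
          Finset.sum_le_sum fun p hp => Finset.sum_le_sum fun p' hp' =>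
            h2 _ _ _ _ (mem_rotPairs.1 hp).1 (mem_rotPairs.1 (Finset.mem_filter.1 hp').1).1
              (Finset.mem_filter.1 hp').2
      _ ≤ ∑ p : (ZMod τ → Fin n) × ZMod τ, ∑ p' : (ZMod τ → Fin n) × ZMod τ,
          δ * (n : ℝ)⁻¹ * (n : ℝ)⁻¹ ^ (Finset.univ.image p.1 ∪ Finset.univ.image p'.1).card := by
          refine (Finset.sum_le_sum fun p _ => Finset.sum_le_sum_of_subset_of_nonneg
            (Finset.subset_univ _) fun p' _ _ => by positivity).trans
            (Finset.sum_le_sum_of_subset_of_nonneg (Finset.subset_univ _)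
              fun p _ _ => Finset.sum_nonneg fun p' _ => by positivity)
      _ = δ * (n : ℝ)⁻¹ * (τ * (τ * ∑ a : ZMod τ → Fin n, ∑ a' : ZMod τ → Fin n,
          (n : ℝ)⁻¹ ^ (Finset.univ.image a ∪ Finset.univ.image a').card)) := by
          simp only [Fintype.sum_prod_type, Finset.sum_const, Finset.card_univ, ZMod.card,
            nsmul_eq_mul, ← Finset.mul_sum]
      _ ≤ _ := by
        rw [hB₂]
        gcongr
        exact sum_sum_inv_pow_card_image_union_le _ _ hn
  have hδ1 : δ * B₁ ≤ ε := by
    rw [hδdef, div_mul_eq_mul_div, div_le_iff₀ hB]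
    exact mul_le_mul_of_nonneg_left (by rw [hB₂]; linarith [hB₂ ▸ (by positivity : 0 ≤ B₂)]) hε.le
  have hδ2 : δ * B₂ ≤ ε := by
    rw [hδdef, div_mul_eq_mul_div, div_le_iff₀ hB]
    exact mul_le_mul_of_nonneg_left (by linarith [hB₁ ▸ (by positivity : 0 ≤ B₁)]) hε.le
  have e : ∀ B, (n : ℝ) * (δ * (n : ℝ)⁻¹ * B) = δ * B := fun B => by field_simp
  rw [← mul_sub, abs_le]
  constructor
  · have := mul_le_mul_of_nonneg_left (hlow.trans (add_le_add_right hs2 _)) hn0.le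
    rw [mul_add, e] at this
    linarith
  · have := mul_le_mul_of_nonneg_left (hup.trans (add_le_add_right hs1 _)) hn0.le
    rw [mul_add, e] at this
    linarith

end Counting

/-- if `σ ∣ τ`, the probability that a uniformly random `n`-state
rule has a weakly robust periodic solution with temporal period `τ` and spatial
period `σ` is `c(τ,σ)/n + o(1/n)`. -/
theorem wrps_probability_fixed_periods (τ σ : ℕ) (hτ : 1 ≤ τ) (hσ : 1 ≤ σ)
    (hdvd : σ ∣ τ) :
    ∃ c : ℝ, Filter.Tendsto
      (fun n : ℕ => (n : ℝ) *
        ((Nat.card {f : CARule n // ∃ ξ : ℤ → Fin n,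
            IsPS f ξ τ σ ∧ IsWeaklyRobust f ξ} : ℝ) / (n : ℝ) ^ (n ^ 2)))
      Filter.atTop (nhds c) := by
  have : NeZero τ := ⟨by omega⟩
  have : NeZero σ := ⟨by omega⟩
  obtain ⟨c, hc⟩ := exists_tendsto_mul_rotMean τ σ
  refine ⟨c, ?_⟩
  have hiff : ∀ (n : ℕ) (f : CARule n), (∃ ξ : ℤ → Fin n, IsPS f ξ τ σ ∧ IsWeaklyRobust f ξ) ↔
      ∃ T : ZMod τ × ZMod σ → Fin n, RobustTile f T := fun n f =>
    ⟨fun ⟨_, h, hr⟩ => exists_robustTile h hr, fun ⟨_, hT⟩ => hT.exists_isPS⟩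
  simp only [hiff]
  have hdiff : Tendsto (fun n : ℕ => (n : ℝ) * ruleDensity (fun f : CARule n =>
      ∃ T : ZMod τ × ZMod σ → Fin n, RobustTile f T) - n * rotMean τ σ n) atTop (nhds 0) := by
    rw [Metric.tendsto_nhds]
    intro ε hε
    filter_upwards [eventually_abs_ruleDensity_sub_rotMean_le τ σ (half_pos hε)] with n hn
    rw [Real.dist_eq, sub_zero]
    linarith
  have := hdiff.add hc
  simpa [ruleDensity] using this
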